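/- arXiv:1701.09148 — 4 statements merged into one kernel-verified Lean document; each statement's English description precedes it below -/
import Mathlib

section
/- Let n, k, r be positive integers with k ≥ 2 and n = kr, let λ = k − 1, and let 1 ≤ m ≤ r. Under the uniform probability measure on the set of {0,k}-mappings on [n], the probability that a mapping has exactly m cyclic nodes equals λ · k^{m−1} · C(r−1, m−1) / C(n−1, m), where C(a,b) denotes the binomial coefficient. -/
open Filter Finset Asymptotics MeasureTheory

noncomputable section

open scoped Classical

/-- `f` is a `{0,k}`-mapping: every point has either `0` or `k` preimages. -/
def IsZKMap {n : ℕ} (k : ℕ) (f : Fin n → Fin n) : Prop :=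
  ∀ y : Fin n,
    (Finset.univ.filter fun x => f x = y).card = 0 ∨
    (Finset.univ.filter fun x => f x = y).card = k

/-- The finite set of `{0,k}`-mappings on `[n]`. -/
def zkMaps (n k : ℕ) : Finset (Fin n → Fin n) :=
  Finset.univ.filter fun f => IsZKMap k f

/-- The set of cyclic nodes of `f`. -/
def cyclicSet {n : ℕ} (f : Fin n → Fin n) : Finset (Fin n) :=
  Finset.univ.filter fun x => ∃ m, 0 < m ∧ f^[m] x = x

/-- `Z f`: the number of cyclic nodes of `f`. -/
def Zmap {n : ℕ} (f : Fin n → Fin n) : ℕ := (cyclicSet f).card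

/-- The cycles of `f`: the orbits of the cyclic nodes under `f`. -/
def cyclesOf {n : ℕ} (f : Fin n → Fin n) : Finset (Finset (Fin n)) :=
  (cyclicSet f).image fun x => (cyclicSet f).filter fun y => ∃ m, f^[m] x = y

/-- `T f`: the least common multiple of the cycle lengths of `f`. -/
def Tmap {n : ℕ} (f : Fin n → Fin n) : ℕ := (cyclesOf f).lcm Finset.card

/-- `B f`: the product of the cycle lengths of `f`, counted with multiplicity. -/
def Bmap {n : ℕ} (f : Fin n → Fin n) : ℕ := ∏ c ∈ cyclesOf f, c.card

/-- `C f`: the number of cycles of `f`. -/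
def Cmap {n : ℕ} (f : Fin n → Fin n) : ℕ := (cyclesOf f).card

/-- Uniform probability of the event `p` over `{0,k}`-mappings on `[n]`. -/
def zkProb (n k : ℕ) (p : (Fin n → Fin n) → Prop) : ℝ :=
  (((zkMaps n k).filter p).card : ℝ) / ((zkMaps n k).card : ℝ)

/-- Expectation of `X` under the uniform measure on `{0,k}`-mappings on `[n]`. -/
def zkExp (n k : ℕ) (X : (Fin n → Fin n) → ℝ) : ℝ :=
  (∑ f ∈ zkMaps n k, X f) / ((zkMaps n k).card : ℝ)

/-- The standard normal cumulative distribution function. -/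
def stdNormalCDF (x : ℝ) : ℝ :=
  (Real.sqrt (2 * Real.pi))⁻¹ * ∫ t in Set.Iic x, Real.exp (-t ^ 2 / 2)

/-- `M m`: the average order of a uniformly random permutation of `[m]`. -/
def Mperm (m : ℕ) : ℝ :=
  (∑ σ : Equiv.Perm (Fin m), (orderOf σ : ℝ)) / (m.factorial : ℝ)

theorem injOn_update_insert {V : Type*} [DecidableEq V] {g : V → V} {A : Finset V} {x t : V}
    (hg : Set.InjOn g A) (hx : x ∉ A) (htg : t ∉ A.image g) :
    Set.InjOn (Function.update g x t) (insert x A : Finset V) := by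
  rw [Finset.coe_insert, Set.injOn_insert (by simpa using hx)]
  have heq : Set.EqOn (Function.update g x t) g A := fun y hy =>
    Function.update_of_ne (ne_of_mem_of_not_mem (Finset.mem_coe.mp hy) hx) _ _
  refine ⟨hg.congr heq.symm, ?_⟩
  rw [heq.image_eq, Function.update_self]
  simpa using htg

/-- The permutations `π` that agree with `g` on `A` and for which every point reaches `A` under
iteration of `f ∘ π`. -/
def completions {V : Type*} [Fintype V] [DecidableEq V] (f g : V → V) (A : Finset V) :
    Finset (Equiv.Perm V) :=
  Finset.univ.filter fun π => (∀ x ∈ A, π x = g x) ∧ ∀ x, ∃ i, (f ∘ π)^[i] x ∈ A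

section Completions

variable {V : Type*} [Fintype V] [DecidableEq V] {f g : V → V} {A : Finset V}

theorem mem_completions {π : Equiv.Perm V} :
    π ∈ completions f g A ↔ (∀ x ∈ A, π x = g x) ∧ ∀ x, ∃ i, (f ∘ π)^[i] x ∈ A := by
  simp [completions]

theorem card_completions_univ (hg : Function.Injective g) :
    (completions f g Finset.univ).card = 1 := by
  rw [Finset.card_eq_one]
  refine ⟨Equiv.ofBijective g (Finite.injective_iff_bijective.mp hg), ?_⟩
  ext π
  simp only [mem_completions, Finset.mem_univ, forall_const, Finset.mem_singleton]
  constructor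
  · rintro ⟨h, -⟩
    ext x
    simp [h]
  · rintro rfl
    exact ⟨fun x => rfl, fun x => ⟨0, trivial⟩⟩

theorem completions_eq_empty (hg : Set.InjOn g A) (hgA : ∀ x ∈ A, f (g x) ∈ A)
    (hA : A ≠ Finset.univ) (hs : (Finset.univ.filter fun y => f y ∈ A).card = A.card) :
    completions f g A = ∅ := by
  have himg : A.image g = Finset.univ.filter fun y => f y ∈ A := by
    apply Finset.eq_of_subset_of_card_le
    · intro y hy
      obtain ⟨x, hx, rfl⟩ := Finset.mem_image.mp hy
      simpa using hgA x hx
    · rw [hs, Finset.card_image_of_injOn hg]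
  rw [Finset.eq_empty_iff_forall_notMem]
  intro π hπ
  obtain ⟨hπg, hπA⟩ := mem_completions.mp hπ
  have hback : ∀ y, f (π y) ∈ A → y ∈ A := by
    intro y hy
    have hy' : π y ∈ A.image g := by
      rw [himg]
      simpa using hy
    obtain ⟨a, ha, hay⟩ := Finset.mem_image.mp hy'
    rw [← hπg a ha] at hay
    exact π.injective hay ▸ ha
  have hiter : ∀ i x, (f ∘ π)^[i] x ∈ A → x ∈ A := by
    intro i
    induction i with
    | zero => exact fun x hx => hx
    | succ i ih => exact fun x hx => hback x (ih _ hx)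
  exact hA (Finset.eq_univ_of_forall fun x => (hπA x).elim fun i hi => hiter i x hi)

theorem completions_eq_biUnion {t : V} (ht : f t ∈ A) (htg : t ∉ A.image g) :
    completions f g A =
      Aᶜ.biUnion fun x => completions f (Function.update g x t) (insert x A) := by
  ext π
  simp only [Finset.mem_biUnion, mem_completions, Finset.mem_compl]
  constructor
  · rintro ⟨hπg, hπA⟩
    have hx : π.symm t ∉ A := fun hx =>
      htg (Finset.mem_image.mpr ⟨π.symm t, hx, by simp [← hπg _ hx]⟩)
    refine ⟨π.symm t, hx, fun y hy => ?_, fun y => ?_⟩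
    · rcases Finset.mem_insert.mp hy with rfl | hy
      · simp
      · rw [Function.update_of_ne (ne_of_mem_of_not_mem hy hx), hπg y hy]
    · obtain ⟨i, hi⟩ := hπA y
      exact ⟨i, Finset.mem_insert_of_mem hi⟩
  · rintro ⟨x, hx, hπg, hπA⟩
    refine ⟨fun y hy => ?_, fun y => ?_⟩
    · rw [hπg y (Finset.mem_insert_of_mem hy),
        Function.update_of_ne (ne_of_mem_of_not_mem hy hx)]
    · obtain ⟨i, hi⟩ := hπA y
      rcases Finset.mem_insert.mp hi with hi | hi
      · refine ⟨i + 1, ?_⟩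
        rw [Function.iterate_succ_apply', hi, Function.comp_apply,
          hπg x (Finset.mem_insert_self x A), Function.update_self]
        exact ht
      · exact ⟨i, hi⟩

theorem card_completions_eq_sum {t : V} (ht : f t ∈ A) (htg : t ∉ A.image g) :
    (completions f g A).card =
      ∑ x ∈ Aᶜ, (completions f (Function.update g x t) (insert x A)).card := by
  rw [completions_eq_biUnion ht htg, Finset.card_biUnion]
  intro x _ y _ hxy
  rw [Function.onFun, Finset.disjoint_left]
  intro π hπx hπy
  have h₁ := (mem_completions.mp hπx).1 x (Finset.mem_insert_self x A)
  have h₂ := (mem_completions.mp hπy).1 y (Finset.mem_insert_self y A)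
  rw [Function.update_self] at h₁ h₂
  exact hxy (π.injective (h₁.trans h₂.symm))

theorem card_filter_mem_insert {x : V} (hx : x ∉ A) :
    (Finset.univ.filter fun y => f y ∈ insert x A).card =
      (Finset.univ.filter fun y => f y = x).card + (Finset.univ.filter fun y => f y ∈ A).card := by
  simp only [Finset.mem_insert]
  rw [Finset.filter_or, Finset.card_union_of_disjoint]
  rw [Finset.disjoint_filter]
  rintro y - rfl
  exact hx

/-- The number of ways to complete a closed partial assignment `g` on `A` to a permutation `π`
such that every point reaches `A` under `f ∘ π`; here `s` is the number of points `y` with `f y ∈ A`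
that are not yet used by `g`. -/
theorem card_completions (u s : ℕ) (hg : Set.InjOn g A) (hgA : ∀ x ∈ A, f (g x) ∈ A)
    (hu : Aᶜ.card = u + 1) (hs : (Finset.univ.filter fun y => f y ∈ A).card = A.card + s) :
    (completions f g A).card = s * u.factorial := by
  induction u generalizing s g A with
  | zero =>
    rcases s with _ | s
    · rw [completions_eq_empty hg hgA _ hs]
      · simp
      · rintro rfl
        simp at hu
    have hlt : (A.image g).card < (Finset.univ.filter fun y => f y ∈ A).card := by
      rw [Finset.card_image_of_injOn hg]
      lia
    obtain ⟨t, ht, htg⟩ := Finset.exists_mem_notMem_of_card_lt_card hlt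
    have hs0 : s = 0 := by
      have h₁ := Finset.card_le_univ (Finset.univ.filter fun y => f y ∈ A)
      have h₂ := Finset.card_add_card_compl A
      lia
    obtain ⟨x, hx⟩ := Finset.card_eq_one.mp hu
    have hxA : x ∉ A := by
      rw [← Finset.mem_compl, hx]
      simp
    have huniv : insert x A = Finset.univ := by
      rw [Finset.insert_eq, ← hx, Finset.union_comm, Finset.union_compl]
    have hinj := injOn_update_insert hg hxA htg
    rw [card_completions_eq_sum (by simpa using ht) htg, hx, Finset.sum_singleton, huniv,
      card_completions_univ, hs0]
    · simp
    · rw [huniv, Finset.coe_univ] at hinj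
      exact Set.injOn_univ.mp hinj
  | succ u ih =>
    rcases s with _ | s
    · rw [completions_eq_empty hg hgA _ hs]
      · simp
      · rintro rfl
        simp at hu
    have hlt : (A.image g).card < (Finset.univ.filter fun y => f y ∈ A).card := by
      rw [Finset.card_image_of_injOn hg]
      lia
    obtain ⟨t, ht, htg⟩ := Finset.exists_mem_notMem_of_card_lt_card hlt
    have ht : f t ∈ A := by simpa using ht
    have hstep : ∀ x ∈ Aᶜ, (completions f (Function.update g x t) (insert x A)).card =
        (s + (Finset.univ.filter fun y => f y = x).card) * u.factorial := by
      intro x hx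
      have hxA : x ∉ A := Finset.mem_compl.mp hx
      apply ih _ (injOn_update_insert hg hxA htg)
      · intro y hy
        rcases Finset.mem_insert.mp hy with rfl | hy
        · rw [Function.update_self]
          exact Finset.mem_insert_of_mem ht
        · rw [Function.update_of_ne (ne_of_mem_of_not_mem hy hxA)]
          exact Finset.mem_insert_of_mem (hgA y hy)
      · have h₁ := Finset.card_add_card_compl A
        have h₂ := Finset.card_add_card_compl (insert x A)
        rw [Finset.card_insert_of_notMem hxA] at h₂
        lia
      · rw [card_filter_mem_insert hxA, Finset.card_insert_of_notMem hxA]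
        lia
    have hdeg : ∑ x ∈ Aᶜ, (Finset.univ.filter fun y => f y = x).card + (s + 1) = u + 2 := by
      have h₁ := Finset.card_add_card_compl A
      have h₂ := Finset.card_add_card_compl (Finset.univ.filter fun y => f y ∈ A)
      have h₃ : (Finset.univ.filter fun y => f y ∈ A)ᶜ.card =
          ∑ x ∈ Aᶜ, (Finset.univ.filter fun y => f y = x).card := by
        rw [Finset.card_eq_sum_card_fiberwise (f := f) (t := Aᶜ)]
        · refine Finset.sum_congr rfl fun x hx => congrArg Finset.card ?_
          ext y
          simp only [Finset.mem_filter, Finset.mem_compl, Finset.mem_univ, true_and] at hx ⊢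
          exact ⟨fun h => h.2, fun h => ⟨h ▸ hx, h⟩⟩
        · intro y hy
          simpa using hy
      lia
    rw [card_completions_eq_sum ht htg, Finset.sum_congr rfl hstep, ← Finset.sum_mul,
      Finset.sum_add_distrib, Finset.sum_const, hu, smul_eq_mul, Nat.factorial_succ, ← mul_assoc]
    congr 1
    linarith

end Completions

section Cyclic

variable {n : ℕ} {f h : Fin n → Fin n} {C : Finset (Fin n)}

theorem mem_cyclicSet {x : Fin n} : x ∈ cyclicSet h ↔ x ∈ Function.periodicPts h := by
  simp [cyclicSet, Function.mem_periodicPts, Function.IsPeriodicPt, Function.IsFixedPt]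

theorem cyclicSet_eq_iff :
    cyclicSet h = C ↔
      (∀ x ∈ C, h x ∈ C) ∧ Set.InjOn h C ∧ ∀ x, ∃ i, h^[i] x ∈ C := by
  constructor
  · rintro rfl
    have hbij := Function.bijOn_periodicPts h
    have hcoe : (cyclicSet h : Set (Fin n)) = Function.periodicPts h := by
      ext x
      simp [mem_cyclicSet]
    refine ⟨fun x hx => ?_, hcoe ▸ hbij.injOn, fun x => ?_⟩
    · exact mem_cyclicSet.mpr (hbij.mapsTo (mem_cyclicSet.mp hx))
    · obtain ⟨i, j, hij, heq⟩ := Finite.exists_ne_map_eq_of_infinite fun i => h^[i] x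
      wlog hlt : i < j generalizing i j
      · exact this j i hij.symm heq.symm (by lia)
      refine ⟨i, mem_cyclicSet.mpr (Function.mk_mem_periodicPts (n := j - i) (by lia) ?_)⟩
      change h^[j - i] (h^[i] x) = h^[i] x
      rw [← Function.iterate_add_apply, Nat.sub_add_cancel hlt.le]
      exact heq.symm
  · rintro ⟨hmaps, hinj, hreach⟩
    have hiter : ∀ i, ∀ x ∈ C, h^[i] x ∈ C := by
      intro i
      induction i with
      | zero => exact fun x hx => hx
      | succ i ih => exact fun x hx => ih _ (hmaps x hx)
    ext x
    rw [mem_cyclicSet]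
    constructor
    · rintro ⟨p, hp, hpx⟩
      obtain ⟨i, hi⟩ := hreach x
      have hper : h^[p * i] x = x := hpx.mul_const i
      have hle : i ≤ p * i := Nat.le_mul_of_pos_left i hp
      rw [← hper, ← Nat.sub_add_cancel hle, Function.iterate_add_apply]
      exact hiter _ _ hi
    · intro hx
      let φ : C → C := fun c => ⟨h c, hmaps c c.2⟩
      have hφ : Function.Injective φ := fun a b hab =>
        Subtype.ext (hinj a.2 b.2 (congrArg Subtype.val hab))
      have hsemi : Function.Semiconj Subtype.val φ h := fun _ => rfl
      obtain ⟨p, hp, hpx⟩ := hφ.mem_periodicPts ⟨x, hx⟩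
      exact ⟨p, hp, hpx.map hsemi⟩

theorem card_perm_cyclicSet_eq_zero {c : Fin n} (hc : c ∈ C) (hf : ∀ x, f x ≠ c) :
    (Finset.univ.filter fun π : Equiv.Perm (Fin n) => cyclicSet (f ∘ π) = C).card = 0 := by
  rw [Finset.card_eq_zero, Finset.filter_eq_empty_iff]
  rintro π - rfl
  obtain ⟨x, -, hx⟩ := (Function.bijOn_periodicPts (f ∘ π)).surjOn (mem_cyclicSet.mp hc)
  exact hf _ hx

theorem card_biUnion_piFinset_fiber {k : ℕ}
    (hk : ∀ c ∈ C, (Finset.univ.filter fun x => f x = c).card = k) :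
    ((Finset.univ : Finset (Equiv.Perm C)).biUnion fun τ =>
      Fintype.piFinset fun c : C => Finset.univ.filter fun y => f y = τ c).card =
      C.card.factorial * k ^ C.card := by
  rw [Finset.card_biUnion]
  · simp [Fintype.card_piFinset, hk, Fintype.card_perm]
  · intro τ _ τ' _ hne
    rw [Function.onFun, Finset.disjoint_left]
    intro j hj hj'
    apply hne
    ext c
    have h₁ := Fintype.mem_piFinset.mp hj c
    have h₂ := Fintype.mem_piFinset.mp hj' c
    simp only [Finset.mem_filter, Finset.mem_univ, true_and] at h₁ h₂
    rw [← h₁, ← h₂]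

theorem card_perm_cyclicSet_eq {k u : ℕ} (hk1 : 1 ≤ k)
    (hk : ∀ c ∈ C, (Finset.univ.filter fun x => f x = c).card = k) (hu : Cᶜ.card = u + 1) :
    (Finset.univ.filter fun π : Equiv.Perm (Fin n) => cyclicSet (f ∘ π) = C).card =
      C.card.factorial * k ^ C.card * ((k - 1) * C.card * u.factorial) := by
  rw [← card_biUnion_piFinset_fiber hk]
  rw [Finset.card_eq_sum_card_fiberwise (f := fun π (c : C) => π c)
    (t := (Finset.univ : Finset (Equiv.Perm C)).biUnion fun τ =>
      Fintype.piFinset fun c : C => Finset.univ.filter fun y => f y = τ c)]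
  · rw [← smul_eq_mul, ← Finset.sum_const]
    refine Finset.sum_congr rfl fun j hj => ?_
    obtain ⟨τ, -, hτ⟩ := Finset.mem_biUnion.mp hj
    have hτ : ∀ c, f (j c) = τ c := fun c => by simpa using Fintype.mem_piFinset.mp hτ c
    let g : Fin n → Fin n := fun x => if hx : x ∈ C then j ⟨x, hx⟩ else x
    have hgj : ∀ x (hx : x ∈ C), g x = j ⟨x, hx⟩ := fun x hx => dif_pos hx
    have hfg : ∀ x (hx : x ∈ C), f (g x) = τ ⟨x, hx⟩ := fun x hx => by rw [hgj x hx, hτ]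
    have hfinj : Set.InjOn (f ∘ g) C := by
      intro x hx y hy hxy
      rw [Function.comp_apply, Function.comp_apply, hfg x hx, hfg y hy] at hxy
      exact congrArg Subtype.val (τ.injective (Subtype.ext hxy))
    have hfC : ∀ x ∈ C, f (g x) ∈ C := fun x hx => by
      rw [hfg x hx]
      exact (τ ⟨x, hx⟩).2
    rw [← card_completions (f := f) (g := g) u _ hfinj.of_comp hfC hu]
    · congr 1
      ext π
      rw [mem_completions, Finset.mem_filter, Finset.mem_filter, cyclicSet_eq_iff]
      have hiff : (fun c : C => π c) = j ↔ ∀ x ∈ C, π x = g x := by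
        constructor
        · rintro rfl x hx
          rw [hgj x hx]
        · intro hx
          ext c
          rw [hx c c.2, hgj c c.2]
      rw [hiff]
      constructor
      · rintro ⟨⟨-, -, -, hreach⟩, hπ⟩
        exact ⟨hπ, hreach⟩
      · rintro ⟨hπ, hreach⟩
        refine ⟨⟨Finset.mem_univ _, fun x hx => ?_, ?_, hreach⟩, hπ⟩
        · rw [Function.comp_apply, hπ x hx]
          exact hfC x hx
        · refine hfinj.congr fun x hx => ?_
          rw [Function.comp_apply, Function.comp_apply, hπ x hx]
    · rw [Finset.card_eq_sum_card_fiberwise (f := f) (t := C)]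
      · have hfib : ∀ c ∈ C,
            ((Finset.univ.filter fun y => f y ∈ C).filter fun y => f y = c).card = k := by
          intro c hc
          rw [← hk c hc, Finset.filter_filter]
          congr 1
          ext y
          simp only [Finset.mem_filter, Finset.mem_univ, true_and]
          exact ⟨fun h => h.2, fun h => ⟨h ▸ hc, h⟩⟩
        rw [Finset.sum_congr rfl hfib, Finset.sum_const, smul_eq_mul]
        obtain ⟨l, rfl⟩ := Nat.exists_eq_add_of_le hk1
        rw [Nat.add_sub_cancel_left]
        ring
      · intro y hy
        simpa using hy
  · intro π hπ
    simp only [Finset.coe_filter, Finset.mem_univ, true_and, Set.mem_ofPred_eq,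
      cyclicSet_eq_iff] at hπ
    obtain ⟨hmaps, hinj, -⟩ := hπ
    let φ : C → C := fun c => ⟨f (π c), hmaps c c.2⟩
    have hφ : Function.Injective φ := fun a b hab =>
      Subtype.ext (hinj a.2 b.2 (congrArg Subtype.val hab))
    refine Finset.mem_coe.mpr (Finset.mem_biUnion.mpr
      ⟨Equiv.ofBijective φ (Finite.injective_iff_bijective.mp hφ), Finset.mem_univ _, ?_⟩)
    rw [Fintype.mem_piFinset]
    intro c
    simp [φ]

end Cyclic

section ZeroK

variable {n k r : ℕ} {f : Fin n → Fin n}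

theorem mem_zkMaps : f ∈ zkMaps n k ↔ IsZKMap k f := by simp [zkMaps]

theorem comp_perm_mem_zkMaps (hf : f ∈ zkMaps n k) (π : Equiv.Perm (Fin n)) :
    f ∘ π ∈ zkMaps n k := by
  rw [mem_zkMaps] at hf ⊢
  intro y
  have hcard : (Finset.univ.filter fun x => (f ∘ π) x = y).card =
      (Finset.univ.filter fun x => f x = y).card :=
    Finset.card_equiv π fun x => by simp
  rw [hcard]
  exact hf y

theorem card_fiber_of_mem_image (hf : f ∈ zkMaps n k) {y : Fin n}
    (hy : y ∈ Finset.univ.image f) : (Finset.univ.filter fun x => f x = y).card = k := by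
  refine (mem_zkMaps.mp hf y).resolve_left fun h => ?_
  obtain ⟨x, -, hx⟩ := Finset.mem_image.mp hy
  exact Finset.filter_eq_empty_iff.mp (Finset.card_eq_zero.mp h) (Finset.mem_univ x) hx

theorem card_image_mul (hf : f ∈ zkMaps n k) : (Finset.univ.image f).card * k = n := by
  have h := Finset.card_eq_sum_card_image f Finset.univ
  rw [Finset.sum_congr rfl fun y hy => card_fiber_of_mem_image hf hy, Finset.sum_const,
    Finset.card_univ, Fintype.card_fin, smul_eq_mul] at h
  exact h.symm

theorem zkMaps_nonempty (hk : 1 ≤ k) (hn : n = k * r) : (zkMaps n k).Nonempty := by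
  subst hn
  let e : Fin k × Fin r ≃ Fin (k * r) := finProdFinEquiv
  let ι : Fin r → Fin (k * r) := Fin.castLE (Nat.le_mul_of_pos_left r hk)
  have hι : Function.Injective ι := Fin.castLE_injective _
  refine ⟨fun x => ι (e.symm x).2, mem_zkMaps.mpr fun y => ?_⟩
  by_cases hy : ∃ i, ι i = y
  · right
    obtain ⟨i, rfl⟩ := hy
    have hcard : (Finset.univ.filter fun x => ι (e.symm x).2 = ι i).card =
        ((Finset.univ : Finset (Fin k)) ×ˢ ({i} : Finset (Fin r))).card :=
      Finset.card_equiv e.symm fun x => by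
        rw [Finset.mem_product]
        simp [hι.eq_iff]
    rw [hcard]
    simp
  · left
    rw [Finset.card_eq_zero, Finset.filter_eq_empty_iff]
    exact fun x _ hx => hy ⟨_, hx⟩

theorem card_perm_Zmap_eq {m u : ℕ} (hk : 1 ≤ k) (hn : n = k * r) (hu : n = m + (u + 1))
    (hf : f ∈ zkMaps n k) :
    (Finset.univ.filter fun π : Equiv.Perm (Fin n) => Zmap (f ∘ π) = m).card =
      r.choose m * (m.factorial * k ^ m * ((k - 1) * m * u.factorial)) := by
  have hr : (Finset.univ.image f).card = r := by
    have h := (card_image_mul hf).trans hn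
    rw [mul_comm] at h
    exact Nat.eq_of_mul_eq_mul_left hk h
  rw [Finset.card_eq_sum_card_fiberwise (f := fun π : Equiv.Perm (Fin n) => cyclicSet (f ∘ π))
    (t := Finset.univ.powersetCard m)]
  · rw [← Finset.sum_subset (Finset.powersetCard_mono (Finset.subset_univ (Finset.univ.image f)))]
    · rw [← hr, ← Finset.card_powersetCard, ← smul_eq_mul, ← Finset.sum_const]
      refine Finset.sum_congr rfl fun C hC => ?_
      obtain ⟨hCf, rfl⟩ := Finset.mem_powersetCard.mp hC
      rw [← card_perm_cyclicSet_eq (f := f) hk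
        (fun c hc => card_fiber_of_mem_image hf (hCf hc)), Finset.filter_filter]
      · congr 1
        ext π
        simp only [Finset.mem_filter, Finset.mem_univ, true_and, and_iff_right_iff_imp]
        rintro rfl
        rfl
      · rw [Finset.card_compl, Fintype.card_fin]
        lia
    · intro C hC hCf
      obtain ⟨-, rfl⟩ := Finset.mem_powersetCard.mp hC
      rw [Finset.mem_powersetCard, and_iff_left rfl, Finset.not_subset] at hCf
      obtain ⟨c, hc, hcf⟩ := hCf
      rw [Finset.filter_filter, ← Nat.le_zero,
        ← card_perm_cyclicSet_eq_zero hc fun x hx =>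
          hcf (Finset.mem_image.mpr ⟨x, Finset.mem_univ x, hx⟩)]
      exact Finset.card_le_card fun π hπ => by
        simp only [Finset.mem_filter, Finset.mem_univ, true_and] at hπ ⊢
        exact hπ.2
  · intro π hπ
    simpa [Finset.mem_powersetCard, Zmap] using (Finset.mem_filter.mp hπ).2

/-- Precomposition with a uniform random permutation preserves the uniform measure on
`{0,k}`-mappings. -/
theorem card_filter_zkMaps_mul_factorial {N : ℕ} (p : (Fin n → Fin n) → Prop)
    (hN : ∀ f ∈ zkMaps n k,
      (Finset.univ.filter fun π : Equiv.Perm (Fin n) => p (f ∘ π)).card = N) :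
    ((zkMaps n k).filter p).card * n.factorial = (zkMaps n k).card * N := by
  have hcomp : ∀ π : Equiv.Perm (Fin n),
      ((zkMaps n k).filter fun f => p (f ∘ π)).card = ((zkMaps n k).filter p).card := by
    intro π
    refine Finset.card_equiv (π.symm.arrowCongr (Equiv.refl _)) fun f => ?_
    have heq : (π.symm.arrowCongr (Equiv.refl (Fin n))) f = f ∘ π := rfl
    rw [heq, Finset.mem_filter, Finset.mem_filter]
    refine and_congr_left fun _ => ⟨fun h => comp_perm_mem_zkMaps h π, fun h => ?_⟩
    have h' := comp_perm_mem_zkMaps h π.symm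
    rwa [Function.comp_assoc, Equiv.self_comp_symm, Function.comp_id] at h'
  have hswap := Finset.sum_card_bipartiteAbove_eq_sum_card_bipartiteBelow
    (s := zkMaps n k) (t := (Finset.univ : Finset (Equiv.Perm (Fin n))))
    fun f (π : Equiv.Perm (Fin n)) => p (f ∘ π)
  simp only [Finset.bipartiteAbove, Finset.bipartiteBelow] at hswap
  rw [Finset.sum_congr rfl hN, Finset.sum_congr rfl fun π _ => hcomp π, Finset.sum_const,
    Finset.sum_const, Finset.card_univ, Fintype.card_perm, Fintype.card_fin, smul_eq_mul,
    smul_eq_mul] at hswap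
  rw [hswap, mul_comm]

end ZeroK

/-- Rubin–Sitgreaves: exact distribution of the number of cyclic
nodes of a uniform random `{0,k}`-mapping on `[n]`, `n = k r`. -/
theorem stmt_0 (n k r m : ℕ) (hk : 2 ≤ k) (hr : 1 ≤ r) (hn : n = k * r)
    (hm1 : 1 ≤ m) (hmr : m ≤ r) :
    zkProb n k (fun f => Zmap f = m) =
      ((k : ℝ) - 1) * (k : ℝ) ^ (m - 1) * ((r - 1).choose (m - 1) : ℝ) /
        ((n - 1).choose m : ℝ) := by
  obtain ⟨u, hu⟩ : ∃ u, n = m + (u + 1) := by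
    refine Nat.exists_eq_add_of_lt (lt_of_le_of_lt hmr ?_)
    nlinarith
  have hcount := card_filter_zkMaps_mul_factorial (n := n) (k := k)
    (N := r.choose m * (m.factorial * k ^ m * ((k - 1) * m * u.factorial)))
    (fun f => Zmap f = m) fun f hf => by
      convert card_perm_Zmap_eq (by lia) hn hu hf
  have hpos : ((zkMaps n k).card : ℝ) ≠ 0 := by
    exact_mod_cast (zkMaps_nonempty (by lia) hn).card_pos.ne'
  obtain ⟨m, rfl⟩ := Nat.exists_eq_add_of_le' hm1
  obtain ⟨r, rfl⟩ := Nat.exists_eq_add_of_le' hr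
  obtain ⟨l, rfl⟩ := Nat.exists_eq_add_of_le' (show 1 ≤ k by lia)
  have hn1 : n - 1 = m + 1 + u := by lia
  have hbinom : ((n - 1).choose (m + 1) : ℝ) * (m + 1).factorial * u.factorial =
      (m + 1 + u).factorial := by
    rw [hn1, Nat.choose_symm_add]
    exact_mod_cast Nat.add_choose_mul_factorial_mul_factorial (m + 1) u
  have hfact : (n.factorial : ℝ) = n * (m + 1 + u).factorial := by
    rw [show n = m + 1 + u + 1 by lia]
    exact_mod_cast Nat.factorial_succ (m + 1 + u)
  have hchoose : ((r + 1).choose (m + 1) : ℝ) * (m + 1) = (r + 1) * r.choose m := by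
    exact_mod_cast (Nat.add_one_mul_choose_eq r m).symm
  have hchoose_pos : ((n - 1).choose (m + 1) : ℝ) ≠ 0 := by
    exact_mod_cast (Nat.choose_pos (by lia)).ne'
  have hfact_pos : (n.factorial : ℝ) ≠ 0 := by exact_mod_cast n.factorial_ne_zero
  have hnR : (n : ℝ) = (l + 1) * (r + 1) := by exact_mod_cast hn
  have hcountR := congrArg (Nat.cast : ℕ → ℝ) hcount
  push_cast [Nat.add_sub_cancel] at hcountR
  rw [zkProb, div_eq_div_iff hpos hchoose_pos]
  apply mul_right_cancel₀ hfact_pos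
  rw [mul_right_comm, hcountR, hfact, ← hbinom, hnR]
  push_cast [Nat.add_sub_cancel]
  linear_combination ((zkMaps n (l + 1)).card : ℝ) * ((m + 1).factorial : ℝ) * (l + 1) ^ (m + 1) * l
    * u.factorial * ((n - 1).choose (m + 1) : ℝ) * hchoose
end
end

section
/- Let k = k(r) ≥ 2 and n = n(r) = k(r)·r be sequences indexed by r, and let x = x(r) be a sequence of nonnegative reals with x = o(r) as r → ∞. Then, as r → ∞: (iii) log Γ(n − x) − log Γ(n) = −x·log n + x²/(2n) + O(x³/n²) + o(1), and (iv) log Γ(r) − log Γ(r − x + 1) = x·log r − log r − x²/(2r) + O(x³/r²) + o(1), where Γ is the real Gamma function. -/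
open Filter Finset Asymptotics MeasureTheory

noncomputable section

open scoped Classical

/-- The error in Stirling's approximation to `log Γ`, up to the additive constant. -/
def stirlingError (y : ℝ) : ℝ :=
  Real.log (Real.Gamma y) - ((y - 1 / 2) * Real.log y - y)

lemma stirlingError_natCast {m : ℕ} (hm : m ≠ 0) :
    stirlingError m = Real.log (Stirling.stirlingSeq m) + 1 / 2 * Real.log 2 := by
  have hm' : (0 : ℝ) < m := by positivity
  have hG : Real.log (m.factorial : ℝ) = Real.log m + Real.log (Real.Gamma m) := by
    rw [← Real.Gamma_nat_eq_factorial, Real.Gamma_add_one hm'.ne',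
      Real.log_mul hm'.ne' (Real.Gamma_pos_of_pos hm').ne']
  rw [Stirling.log_stirlingSeq_formula, hG, Real.log_mul two_ne_zero hm'.ne',
    Real.log_div hm'.ne' (Real.exp_pos 1).ne', Real.log_exp, stirlingError]
  ring

lemma tendsto_stirlingError_natCast :
    ∃ c, Tendsto (fun m : ℕ => stirlingError m) atTop (nhds c) := by
  refine ⟨Real.log √Real.pi + 1 / 2 * Real.log 2, ?_⟩
  have h := (Stirling.tendsto_stirlingSeq_sqrt_pi.log
    (Real.sqrt_pos.2 Real.pi_pos).ne').add_const (1 / 2 * Real.log 2)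
  refine h.congr' ?_
  filter_upwards [eventually_ne_atTop 0] with m hm
  exact (stirlingError_natCast hm).symm

lemma log_Gamma_add_one {y : ℝ} (hy : 0 < y) :
    Real.log (Real.Gamma (y + 1)) = Real.log (Real.Gamma y) + Real.log y := by
  rw [Real.Gamma_add_one hy.ne', Real.log_mul hy.ne' (Real.Gamma_pos_of_pos hy).ne', add_comm]

lemma stirlingError_add_le {m : ℕ} (hm : 2 ≤ m) {t : ℝ} (ht : 0 < t) (ht1 : t ≤ 1) :
    stirlingError (m + t) ≤ stirlingError m + 1 / (m - 1) := by
  have hm' : (2 : ℝ) ≤ m := by exact_mod_cast hm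
  have h := Real.BohrMollerup.f_add_nat_le Real.convexOn_log_Gamma
    (fun {y} hy => log_Gamma_add_one hy) (by omega : m ≠ 0) ht ht1
  simp only [Function.comp_apply] at h
  have hl := Real.one_sub_inv_le_log_of_pos (show 0 < (m + t) / m by positivity)
  rw [Real.log_div (by positivity) (by positivity), inv_div] at hl
  have hmul := mul_le_mul_of_nonneg_left hl (show 0 ≤ (m : ℝ) + t - 1 / 2 by linarith)
  have he : ((m : ℝ) + t - 1 / 2) * (1 - m / (m + t)) = t - t / (2 * (m + t)) := by
    field_simp
    ring
  have hb : t / (2 * (m + t)) ≤ 1 / (m - 1) := by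
    rw [div_le_div_iff₀ (by positivity) (by linarith)]
    nlinarith
  unfold stirlingError
  nlinarith

lemma le_stirlingError_add {m : ℕ} (hm : 2 ≤ m) {t : ℝ} (ht : 0 < t) (ht1 : t ≤ 1) :
    stirlingError m - 2 / (m - 1) ≤ stirlingError (m + t) := by
  have hm' : (2 : ℝ) ≤ m := by exact_mod_cast hm
  have hm1 : (0 : ℝ) < m - 1 := by linarith
  have h := Real.BohrMollerup.f_add_nat_ge Real.convexOn_log_Gamma
    (fun {y} hy => log_Gamma_add_one hy) hm ht
  simp only [Function.comp_apply] at h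
  have hl := Real.log_le_sub_one_of_pos (show 0 < (m + t) / m by positivity)
  rw [Real.log_div (by positivity) (by positivity)] at hl
  have hmul := mul_le_mul_of_nonneg_left hl (show 0 ≤ (m : ℝ) + t - 1 / 2 by linarith)
  have he : ((m : ℝ) + t - 1 / 2) * ((m + t) / m - 1) = t + t * (t - 1 / 2) / m := by
    field_simp
    ring
  have hb : t * (t - 1 / 2) / m ≤ 1 / (m - 1) := by
    have ht2 : t * (t - 1 / 2) ≤ 1 := by nlinarith
    rw [div_le_div_iff₀ (by positivity) hm1]
    nlinarith [mul_le_mul_of_nonneg_right ht2 hm1.le]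
  have hl' := Real.one_sub_inv_le_log_of_pos (show 0 < ((m : ℝ) - 1) / m by positivity)
  rw [Real.log_div hm1.ne' (by positivity), inv_div] at hl'
  have he' : 1 - (m : ℝ) / (m - 1) = -(1 / (m - 1)) := by
    field_simp
    ring
  have hmul' := mul_le_mul_of_nonneg_left hl' ht.le
  have hb' : t * (1 / ((m : ℝ) - 1)) ≤ 1 / (m - 1) :=
    mul_le_of_le_one_left (by positivity) ht1
  have h2 : 2 / ((m : ℝ) - 1) = 1 / (m - 1) + 1 / (m - 1) := by ring
  rw [he'] at hmul'
  unfold stirlingError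
  nlinarith

lemma tendsto_stirlingError : ∃ c, Tendsto stirlingError atTop (nhds c) := by
  obtain ⟨c, hc⟩ := tendsto_stirlingError_natCast
  refine ⟨c, ?_⟩
  have hinv (a : ℝ) : Tendsto (fun m : ℕ => a / ((m : ℝ) - 1)) atTop (nhds 0) :=
    (tendsto_atTop_add_const_right _ (-1) tendsto_natCast_atTop_atTop).const_div_atTop a
  have hlow : Tendsto (fun m : ℕ => stirlingError m - 2 / ((m : ℝ) - 1)) atTop (nhds c) := by
    simpa using hc.sub (hinv 2)
  have hup : Tendsto (fun m : ℕ => stirlingError m + 1 / ((m : ℝ) - 1)) atTop (nhds c) := by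
    simpa using hc.add (hinv 1)
  have hfl : Tendsto (fun y : ℝ => ⌊y⌋₊) atTop atTop := tendsto_nat_floor_atTop
  refine tendsto_of_tendsto_of_tendsto_of_le_of_le' (hlow.comp hfl) (hup.comp hfl) ?_ ?_ <;>
    filter_upwards [eventually_ge_atTop 2] with y hy
  all_goals
    have hm : 2 ≤ ⌊y⌋₊ := Nat.le_floor (by exact_mod_cast hy)
    have hm' : (2 : ℝ) ≤ ⌊y⌋₊ := by exact_mod_cast hm
    have hm1 : (0 : ℝ) < ⌊y⌋₊ - 1 := by linarith
    have hle := Nat.floor_le (show 0 ≤ y by linarith)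
    have hlt := Nat.lt_floor_add_one y
    simp only [Function.comp_apply]
    rcases hle.eq_or_lt with heq | hpos
    · have := congrArg stirlingError heq
      have := div_pos one_pos hm1
      have := div_pos two_pos hm1
      linarith
  · simpa using le_stirlingError_add hm (sub_pos.2 hpos) (by linarith)
  · simpa using stirlingError_add_le hm (sub_pos.2 hpos) (by linarith)

/-- The cubic Taylor remainder of `(1 - u) * log (1 - u)` at `0`. -/
def entropyRemainder (u : ℝ) : ℝ := (1 - u) * Real.log (1 - u) + u - u ^ 2 / 2

lemma abs_entropyRemainder_le {u : ℝ} (hu : 0 ≤ u) (hu' : u ≤ 1 / 2) :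
    |entropyRemainder u| ≤ 2 * u ^ 3 := by
  have h := Real.abs_log_sub_add_sum_range_le (x := u) (by rw [abs_of_nonneg hu]; linarith) 2
  rw [abs_of_nonneg hu, le_div_iff₀ (by linarith)] at h
  nth_rewrite 2 [← abs_of_nonneg (show 0 ≤ 1 - u by linarith)] at h
  rw [← abs_mul] at h
  norm_num only [Finset.sum_range_succ, Finset.sum_range_zero] at h
  have hu3 : 0 ≤ u ^ 3 := by positivity
  rw [abs_le] at h ⊢
  unfold entropyRemainder
  constructor <;> nlinarith

lemma log_Gamma_sub_sub_log_Gamma {y x : ℝ} (hy : 0 < y) (hxy : x < y) :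
    Real.log (Real.Gamma (y - x)) - Real.log (Real.Gamma y) =
      -x * Real.log y + x ^ 2 / (2 * y) + y * entropyRemainder (x / y) +
        (stirlingError (y - x) - stirlingError y - 1 / 2 * Real.log (1 - x / y)) := by
  have hu : 0 < 1 - x / y := by rw [sub_pos, div_lt_one hy]; exact hxy
  have hl : Real.log (y - x) = Real.log y + Real.log (1 - x / y) := by
    rw [← Real.log_mul hy.ne' hu.ne']
    congr 1
    field_simp
  unfold stirlingError entropyRemainder
  rw [hl]
  field_simp
  ring

lemma tendsto_log_one_sub {α : Type*} {l : Filter α} {u : α → ℝ} (hu : Tendsto u l (nhds 0)) :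
    Tendsto (fun a => Real.log (1 - u a)) l (nhds 0) := by
  simpa using (hu.const_sub 1).log (by norm_num)

lemma tendsto_stirlingError_sub {α : Type*} {l : Filter α} {y x : α → ℝ}
    (hy : Tendsto y l atTop) (hu : Tendsto (fun a => x a / y a) l (nhds 0)) :
    Tendsto (fun a => stirlingError (y a - x a) - stirlingError (y a) -
      1 / 2 * Real.log (1 - x a / y a)) l (nhds 0) := by
  obtain ⟨c, hc⟩ := tendsto_stirlingError
  have hyx : Tendsto (fun a => y a - x a) l atTop := by
    refine (hy.atTop_mul_pos one_pos (by simpa using hu.const_sub 1)).congr' ?_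
    filter_upwards [hy.eventually_gt_atTop 0] with a ha
    field_simp
  simpa only [Function.comp_apply, sub_self, mul_zero] using
    ((hc.comp hyx).sub (hc.comp hy)).sub ((tendsto_log_one_sub hu).const_mul (1 / 2))

lemma isBigO_mul_entropyRemainder {α : Type*} {l : Filter α} {y x : α → ℝ}
    (hy : Tendsto y l atTop) (hx : ∀ a, 0 ≤ x a)
    (hu : Tendsto (fun a => x a / y a) l (nhds 0)) :
    (fun a => y a * entropyRemainder (x a / y a)) =O[l] (fun a => x a ^ 3 / y a ^ 2) := by
  refine IsBigO.of_bound 2 ?_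
  filter_upwards [hy.eventually_gt_atTop 0, hu.eventually_le_const (show (0 : ℝ) < 1 / 2 by norm_num)]
    with a ha hua
  have hxa := hx a
  rw [Real.norm_eq_abs, Real.norm_eq_abs, abs_mul, abs_of_pos ha,
    abs_of_nonneg (show 0 ≤ x a ^ 3 / y a ^ 2 by positivity)]
  calc y a * |entropyRemainder (x a / y a)| ≤ y a * (2 * (x a / y a) ^ 3) := by
        gcongr
        exact abs_entropyRemainder_le (by positivity) hua
    _ = 2 * (x a ^ 3 / y a ^ 2) := by field_simp

/-- Gamma-function asymptotics (items (iii) and (iv) of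
Lemma `lemma_equatios_615_616`). -/
theorem stmt_1 (k n : ℕ → ℕ) (x : ℕ → ℝ)
    (hk : ∀ r, 2 ≤ k r) (hn : ∀ r, n r = k r * r)
    (hx0 : ∀ r, 0 ≤ x r)
    (hxo : x =o[atTop] (fun r : ℕ => (r : ℝ))) :
    (∃ E₁ E₂ : ℕ → ℝ,
      (∀ᶠ r : ℕ in atTop,
        Real.log (Real.Gamma ((n r : ℝ) - x r)) - Real.log (Real.Gamma ((n r : ℝ))) =
          -(x r) * Real.log (n r : ℝ) + (x r) ^ 2 / (2 * (n r : ℝ)) + E₁ r + E₂ r) ∧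
      E₁ =O[atTop] (fun r => (x r) ^ 3 / (n r : ℝ) ^ 2) ∧
      Tendsto E₂ atTop (nhds 0)) ∧
    (∃ E₁ E₂ : ℕ → ℝ,
      (∀ᶠ r : ℕ in atTop,
        Real.log (Real.Gamma ((r : ℝ))) - Real.log (Real.Gamma ((r : ℝ) - x r + 1)) =
          (x r) * Real.log (r : ℝ) - Real.log (r : ℝ) - (x r) ^ 2 / (2 * (r : ℝ)) +
            E₁ r + E₂ r) ∧
      E₁ =O[atTop] (fun r => (x r) ^ 3 / (r : ℝ) ^ 2) ∧
      Tendsto E₂ atTop (nhds 0)) := by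
  have hr : Tendsto (fun r : ℕ => (r : ℝ)) atTop atTop := tendsto_natCast_atTop_atTop
  have hrn (r : ℕ) : (r : ℝ) ≤ n r := by
    rw [hn]
    exact_mod_cast Nat.le_mul_of_pos_left r (by have := hk r; omega)
  have hnt : Tendsto (fun r => (n r : ℝ)) atTop atTop := tendsto_atTop_mono hrn hr
  have hur : Tendsto (fun r : ℕ => x r / (r : ℝ)) atTop (nhds 0) := hxo.tendsto_div_nhds_zero
  have hun : Tendsto (fun r => x r / (n r : ℝ)) atTop (nhds 0) := by
    refine squeeze_zero' (Eventually.of_forall fun r => div_nonneg (hx0 r) (Nat.cast_nonneg _)) ?_ hur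
    filter_upwards [eventually_gt_atTop 0] with r hr0
    exact div_le_div_of_nonneg_left (hx0 r) (by exact_mod_cast hr0) (hrn r)
  have hlt : ∀ᶠ r : ℕ in atTop, 0 < (r : ℝ) ∧ x r < r := by
    filter_upwards [hr.eventually_gt_atTop 0, hur.eventually_lt_const one_pos] with r h0 h1
    exact ⟨h0, (div_lt_one h0).1 h1⟩
  refine ⟨⟨_, _, ?_, isBigO_mul_entropyRemainder hnt hx0 hun, tendsto_stirlingError_sub hnt hun⟩,
    _, _, ?_, (isBigO_mul_entropyRemainder hr hx0 hur).neg_left, by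
      simpa only [neg_zero, sub_zero] using
        (tendsto_stirlingError_sub hr hur).neg.sub (tendsto_log_one_sub hur)⟩
  · filter_upwards [hlt] with r ⟨h0, h1⟩
    exact log_Gamma_sub_sub_log_Gamma (h0.trans_le (hrn r)) (h1.trans_le (hrn r))
  · filter_upwards [hlt] with r ⟨h0, h1⟩
    have hu : 0 < 1 - x r / r := by rw [sub_pos, div_lt_one h0]; exact h1
    have hl : Real.log (r - x r) = Real.log r + Real.log (1 - x r / r) := by
      rw [← Real.log_mul h0.ne' hu.ne']
      congr 1
      field_simp
    rw [log_Gamma_add_one (sub_pos.2 h1), hl]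
    linear_combination -log_Gamma_sub_sub_log_Gamma h0 h1
end
end

section
/- Let n, k ≥ 2 be integers with n = kr for some integer r ≥ 1. Let A ⊆ [n] with |A| = m ≤ n/k and let σ be a permutation of [m]. For a mapping f with cyclic set Z(f) = A, write f|_A ≡ σ if φ ∘ f ∘ φ⁻¹ = σ where φ : A → [m] is the unique increasing bijection. Then the conditional probability, under the uniform measure on {0,k}-mappings on [n], that f|_A ≡ σ given that the set of cyclic nodes of f equals A, is exactly 1/m!. Equivalently, m! · #{f a {0,k}-mapping on [n] : Z(f) = A and f|_A ≡ σ} = #{f a {0,k}-mapping on [n] : Z(f) = A}, provided the latter set is nonempty. -/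
open Filter Finset Asymptotics MeasureTheory

noncomputable section

open scoped Classical

/-- The cyclic nodes of `f` are its periodic points. -/
theorem mem_cyclicSet_iff {n : ℕ} (f : Fin n → Fin n) (x : Fin n) :
    x ∈ cyclicSet f ↔ x ∈ Function.periodicPts f := by
  simp [cyclicSet, Function.periodicPts, Function.IsPeriodicPt, Function.IsFixedPt]

theorem bijOn_cyclicSet {n : ℕ} (f : Fin n → Fin n) :
    Set.BijOn f (cyclicSet f) (cyclicSet f) := by
  have h : (cyclicSet f : Set (Fin n)) = Function.periodicPts f := by
    ext x
    exact mem_cyclicSet_iff f x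
  rw [h]
  exact Function.bijOn_periodicPts f

/-- An injective self-map of a finite set has only cyclic nodes there. -/
theorem subset_cyclicSet {n : ℕ} {g : Fin n → Fin n} {A : Finset (Fin n)}
    (hmaps : Set.MapsTo g A A) (hinj : Set.InjOn g A) : A ⊆ cyclicSet g := by
  intro x hx
  have hr : Function.Injective (hmaps.restrict g A A) := hmaps.restrict_inj.2 hinj
  obtain ⟨m, hm, hp⟩ := hr.mem_periodicPts ⟨x, hx⟩
  rw [mem_cyclicSet_iff]
  refine ⟨m, hm, ?_⟩
  have h := congrArg Subtype.val hp
  rwa [hmaps.iterate_restrict] at h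

/-- If `g` permutes the cyclic nodes of `f` and agrees with `f` elsewhere, then `g` has the same
cyclic nodes as `f`. -/
theorem cyclicSet_eq_of_eqOn_compl {n : ℕ} {f g : Fin n → Fin n}
    (hmaps : Set.MapsTo g (cyclicSet f) (cyclicSet f)) (hinj : Set.InjOn g (cyclicSet f))
    (hfg : ∀ x ∉ cyclicSet f, g x = f x) : cyclicSet g = cyclicSet f := by
  refine Finset.Subset.antisymm (fun x hx => ?_) (subset_cyclicSet hmaps hinj)
  by_contra hxA
  obtain ⟨p, hp, hpx⟩ := (mem_cyclicSet_iff g x).1 hx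
  have hout : ∀ j, g^[j] x ∉ cyclicSet f := by
    intro j hj
    have h := hmaps.iterate (p * j - j) hj
    have hle : j ≤ p * j := Nat.le_mul_of_pos_left j hp
    rw [← Function.iterate_add_apply, Nat.sub_add_cancel hle, (hpx.mul_const j).eq] at h
    exact hxA h
  have heq : ∀ j, g^[j] x = f^[j] x := by
    intro j
    induction j with
    | zero => rfl
    | succ j ih =>
      rw [Function.iterate_succ_apply', Function.iterate_succ_apply', hfg _ (hout j), ih]
  exact hxA ((mem_cyclicSet_iff f x).2 ⟨p, hp, (heq p).symm.trans hpx⟩)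

/-- Precomposing with a permutation supported on the cyclic nodes keeps the cyclic nodes. -/
theorem cyclicSet_comp_perm {n : ℕ} {f : Fin n → Fin n} (τ : Equiv.Perm (Fin n))
    (hτ : ∀ x ∉ cyclicSet f, τ x = x) : cyclicSet (f ∘ τ) = cyclicSet f := by
  have hτA : Set.MapsTo τ (cyclicSet f) (cyclicSet f) := by
    intro x hx
    by_contra h
    exact h (by rwa [τ.injective (hτ _ h)])
  refine cyclicSet_eq_of_eqOn_compl ((bijOn_cyclicSet f).mapsTo.comp hτA)
    ((bijOn_cyclicSet f).injOn.comp τ.injective.injOn hτA) fun x hx => ?_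
  rw [Function.comp_apply, hτ x hx]

theorem IsZKMap.comp_perm {n k : ℕ} {f : Fin n → Fin n} (hf : IsZKMap k f)
    (τ : Equiv.Perm (Fin n)) : IsZKMap k (f ∘ τ) := by
  intro y
  have h : (Finset.univ.filter fun x => (f ∘ τ) x = y).card =
      (Finset.univ.filter fun x => f x = y).card :=
    Finset.card_equiv τ (by simp)
  rw [h]
  exact hf y

/-- The `{0,k}`-mappings with set of cyclic nodes `A` which act on `A`, listed in increasing order,
as the permutation `σ`. -/
def zkMapsActingAs {n m : ℕ} (k : ℕ) (A : Finset (Fin n)) (hA : A.card = m)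
    (σ : Equiv.Perm (Fin m)) : Finset (Fin n → Fin n) :=
  (zkMaps n k).filter (fun f => cyclicSet f = A ∧
    ∀ i : Fin m, f ((A.orderIsoOfFin hA i : Fin n)) = (A.orderIsoOfFin hA (σ i) : Fin n))

theorem card_zkMapsActingAs_le {n m : ℕ} (k : ℕ) (A : Finset (Fin n)) (hA : A.card = m)
    (σ π : Equiv.Perm (Fin m)) :
    (zkMapsActingAs k A hA σ).card ≤ (zkMapsActingAs k A hA π).card := by
  let τ : Equiv.Perm (Fin n) := (σ⁻¹ * π).extendDomain (A.orderIsoOfFin hA).toEquiv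
  refine Finset.card_le_card_of_injOn (fun f => f ∘ τ) ?_
    (τ.surjective.injective_comp_right.injOn)
  intro f hf
  simp only [zkMapsActingAs, zkMaps, Finset.coe_filter, Finset.mem_filter, Finset.mem_univ,
    true_and, Set.mem_ofPred_eq] at hf ⊢
  obtain ⟨hk, hc, hs⟩ := hf
  refine ⟨hk.comp_perm τ, ?_, fun i => ?_⟩
  · rw [← hc]
    refine cyclicSet_comp_perm τ fun x hx => ?_
    rw [hc] at hx
    exact Equiv.Perm.extendDomain_apply_not_subtype _ _ hx
  · have h : τ (A.orderIsoOfFin hA i : Fin n) = (A.orderIsoOfFin hA ((σ⁻¹ * π) i) : Fin n) :=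
      Equiv.Perm.extendDomain_apply_image _ (A.orderIsoOfFin hA).toEquiv i
    rw [Function.comp_apply, h, hs]
    simp

/-- A mapping with set of cyclic nodes `A` acts on `A` as some permutation. -/
theorem exists_perm_of_cyclicSet_eq {n m : ℕ} {f : Fin n → Fin n} {A : Finset (Fin n)}
    (hA : A.card = m) (hf : cyclicSet f = A) : ∃ σ : Equiv.Perm (Fin m),
      ∀ i : Fin m, f ((A.orderIsoOfFin hA i : Fin n)) = (A.orderIsoOfFin hA (σ i) : Fin n) := by
  have hb : Set.BijOn f A A := hf ▸ bijOn_cyclicSet f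
  let e : Fin m ≃ A := (A.orderIsoOfFin hA).toEquiv
  let ρ : Equiv.Perm A := hb.equiv f
  refine ⟨(e.trans ρ).trans e.symm, fun i => ?_⟩
  change f (e i) = e (e.symm (ρ (e i)))
  rw [e.apply_symm_apply]
  rfl

theorem sum_card_zkMapsActingAs {n m : ℕ} (k : ℕ) (A : Finset (Fin n)) (hA : A.card = m) :
    ∑ σ : Equiv.Perm (Fin m), (zkMapsActingAs k A hA σ).card =
      ((zkMaps n k).filter (fun f => cyclicSet f = A)).card := by
  rw [← Finset.card_biUnion]
  · congr 1
    ext f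
    simp only [zkMapsActingAs, Finset.mem_biUnion, Finset.mem_univ, true_and, Finset.mem_filter]
    constructor
    · rintro ⟨σ, hk, hc, -⟩
      exact ⟨hk, hc⟩
    · rintro ⟨hk, hc⟩
      obtain ⟨σ, hs⟩ := exists_perm_of_cyclicSet_eq hA hc
      exact ⟨σ, hk, hc, hs⟩
  · intro σ _ π _ hne
    refine Finset.disjoint_left.2 fun f hσ hπ => hne (Equiv.ext fun i => ?_)
    simp only [zkMapsActingAs, Finset.mem_filter] at hσ hπ
    exact (A.orderIsoOfFin hA).injective (Subtype.ext ((hσ.2.2 i).symm.trans (hπ.2.2 i)))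

theorem factorial_mul_card_zkMapsActingAs {n m : ℕ} (k : ℕ) (A : Finset (Fin n))
    (hA : A.card = m) (σ : Equiv.Perm (Fin m)) :
    m.factorial * (zkMapsActingAs k A hA σ).card =
      ((zkMaps n k).filter (fun f => cyclicSet f = A)).card := by
  rw [← sum_card_zkMapsActingAs k A hA, Finset.sum_congr rfl fun π _ =>
    le_antisymm (card_zkMapsActingAs_le k A hA π σ) (card_zkMapsActingAs_le k A hA σ π)]
  simp [Fintype.card_perm]

/-- conditionally on its set of cyclic nodes being `A`, the
restriction of a uniform `{0,k}`-mapping to `A` is a uniform permutation of `A`. -/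
theorem stmt_5 (n k r : ℕ) (hk : 2 ≤ k) (hr : 1 ≤ r) (hn : n = k * r)
    (A : Finset (Fin n)) (m : ℕ) (hA : A.card = m) (hm : m * k ≤ n)
    (σ : Equiv.Perm (Fin m))
    (hne : ((zkMaps n k).filter (fun f => cyclicSet f = A)).Nonempty) :
    ((((zkMaps n k).filter (fun f => cyclicSet f = A ∧
        ∀ i : Fin m, f ((A.orderIsoOfFin hA i : Fin n)) =
          (A.orderIsoOfFin hA (σ i) : Fin n))).card : ℝ) /
      (((zkMaps n k).filter (fun f => cyclicSet f = A)).card : ℝ) =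
        1 / (m.factorial : ℝ)) ∧
    (m.factorial *
      ((zkMaps n k).filter (fun f => cyclicSet f = A ∧
        ∀ i : Fin m, f ((A.orderIsoOfFin hA i : Fin n)) =
          (A.orderIsoOfFin hA (σ i) : Fin n))).card =
      ((zkMaps n k).filter (fun f => cyclicSet f = A)).card) := by
  have key := factorial_mul_card_zkMapsActingAs k A hA σ
  refine ⟨?_, key⟩
  have hpos := Finset.card_pos.2 hne
  rw [div_eq_div_iff (by positivity) (by positivity), one_mul, mul_comm]
  exact_mod_cast key
end
end

section
/- Let k = k(r) ≥ 2 and n = n(r) = k(r)·r be sequences with λ = k − 1 and k = o(n^{1−α}) for some fixed 0 < α < 1. Fix ε ∈ (−1,1), let I = ∫₀^∞ log log(e/(1 − e^{−t})) dt, β₀ = √(8I), β_ε = β₀ + ε, and define φ_{n,ε}(x) = λ·x·k^{x−1}·(Γ(r)/Γ(r − x + 1))·(Γ(n − x)/Γ(n))·exp(β_ε·√(x/log x)). Then there exists a constant c > 0 such that for all sufficiently large r the function x ↦ φ_{n,ε}(x) attains a unique maximum x_* on the interval (c, r), and, with k_ε = (3⁵·β_ε⁴)^{1/3}/8, one has log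 φ_{n,ε}(x_*) = k_ε · (n/λ)^{1/3}/log^{2/3}(n/λ) · (1 + o(1)) as r → ∞. -/
open Filter Finset Asymptotics MeasureTheory

noncomputable section

open scoped Classical

/-- The integral `∫₀^∞ log log (e / (1 - e⁻ᵗ)) dt` is at least `1 / 2`. -/
lemma half_le_integral_log_log :
    1 / 2 ≤ ∫ t in Set.Ioi (0 : ℝ),
      Real.log (Real.log (Real.exp 1 / (1 - Real.exp (-t)))) := by
  have hbounds : ∀ t ∈ Set.Ioi (0 : ℝ),
      Real.exp (-t) / 2 ≤ Real.log (Real.log (Real.exp 1 / (1 - Real.exp (-t)))) ∧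
      Real.log (Real.log (Real.exp 1 / (1 - Real.exp (-t)))) ≤
        2 * (t ^ (-(1 / 2) : ℝ) * Real.exp (-(1 / 2) * t ^ (1 : ℝ))) := by
    intro t ht
    have ht0 : 0 < t := ht
    set w := Real.exp (-t) with hw
    have hw0 : 0 < w := Real.exp_pos _
    have hw1 : w < 1 := by rw [hw, Real.exp_lt_one_iff]; linarith
    have hy : 0 < 1 - w := by linarith
    have hsplit : Real.log (Real.exp 1 / (1 - w)) = 1 - Real.log (1 - w) := by
      rw [Real.log_div (Real.exp_pos 1).ne' hy.ne', Real.log_exp]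
    have hlog : w ≤ -Real.log (1 - w) := by
      have := Real.log_le_sub_one_of_pos hy
      linarith
    rw [hsplit]
    constructor
    · calc w / 2 ≤ 1 - (1 + w)⁻¹ := by
            rw [show 1 - (1 + w)⁻¹ = w / (1 + w) by field_simp; ring]
            exact div_le_div_of_nonneg_left hw0.le (by linarith) (by linarith)
        _ ≤ Real.log (1 + w) := Real.one_sub_inv_le_log_of_pos (by linarith)
        _ ≤ _ := Real.log_le_log (by linarith) (by linarith)
    · have hs : 0 < √(1 - w) := Real.sqrt_pos.2 hy
      have hs2 : √(1 - w) ^ 2 = 1 - w := Real.sq_sqrt hy.le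
      have hs1 : √(1 - w) ≤ 1 := by nlinarith
      have htw : t * w ≤ 1 - w := by
        have h1 : t + 1 ≤ Real.exp t := Real.add_one_le_exp t
        have h2 : Real.exp t * w = 1 := by rw [hw, ← Real.exp_add]; simp
        nlinarith
      have hrhs : t ^ (-(1 / 2) : ℝ) * Real.exp (-(1 / 2) * t ^ (1 : ℝ)) = √w / √t := by
        rw [Real.rpow_neg ht0.le, ← Real.sqrt_eq_rpow, Real.rpow_one, hw, ← Real.exp_half]
        rw [show -(1 / 2) * t = -t / 2 by ring]
        field_simp
      rw [hrhs]
      calc Real.log (1 - Real.log (1 - w)) ≤ (1 - Real.log (1 - w)) - 1 :=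
            Real.log_le_sub_one_of_pos (by linarith)
        _ = 2 * -Real.log (√(1 - w)) := by
            rw [Real.log_sqrt hy.le]; ring
        _ ≤ 2 * ((√(1 - w))⁻¹ - 1) := by
            have := Real.one_sub_inv_le_log_of_pos hs
            linarith
        _ ≤ 2 * (w / √(1 - w)) := by
            have : (√(1 - w))⁻¹ - 1 ≤ w / √(1 - w) := by
              rw [inv_eq_one_div, sub_le_iff_le_add, div_add_one hs.ne']
              gcongr
              nlinarith
            linarith
        _ ≤ 2 * (w / (√t * √w)) := by
            rw [← Real.sqrt_mul ht0.le]
            have : 0 < √(t * w) := Real.sqrt_pos.2 (by positivity)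
            gcongr
        _ = 2 * (√w / √t) := by
            have : √w ≠ 0 := (Real.sqrt_pos.2 hw0).ne'
            have h : √w * √w = w := Real.mul_self_sqrt hw0.le
            congr 1
            field_simp
            nlinarith
  have hdom : IntegrableOn (fun t : ℝ =>
      2 * (t ^ (-(1 / 2) : ℝ) * Real.exp (-(1 / 2) * t ^ (1 : ℝ)))) (Set.Ioi 0) :=
    (integrableOn_rpow_mul_exp_neg_mul_rpow (by norm_num) one_pos (by norm_num)).const_mul 2
  have hmeas : Measurable fun t : ℝ =>
      Real.log (Real.log (Real.exp 1 / (1 - Real.exp (-t)))) := by fun_prop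
  have hint : IntegrableOn (fun t : ℝ =>
      Real.log (Real.log (Real.exp 1 / (1 - Real.exp (-t))))) (Set.Ioi 0) := by
    refine hdom.mono' hmeas.aestronglyMeasurable ?_
    filter_upwards [ae_restrict_mem measurableSet_Ioi] with t ht
    have h := hbounds t ht
    rw [Real.norm_of_nonneg ((by positivity : (0 : ℝ) ≤ Real.exp (-t) / 2).trans h.1)]
    exact h.2
  have hexp : IntegrableOn (fun t : ℝ => Real.exp (-t) / 2) (Set.Ioi 0) :=
    (integrableOn_exp_neg_Ioi 0).div_const 2
  calc (1 / 2 : ℝ) = ∫ t in Set.Ioi (0 : ℝ), Real.exp (-t) / 2 := by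
        rw [integral_div, integral_exp_neg_Ioi_zero]
    _ ≤ _ := setIntegral_mono_on hexp hint measurableSet_Ioi fun t ht => (hbounds t ht).1

lemma two_lt_log_of_exp_two_lt {x : ℝ} (hx : x ∈ Set.Ioi (Real.exp 2)) : 2 < Real.log x :=
  (Real.lt_log_iff_exp_lt ((Real.exp_pos 2).trans hx)).2 hx

lemma hasDerivAt_div_log {x : ℝ} (hx : x ∈ Set.Ioi (Real.exp 2)) :
    HasDerivAt (fun y => y / Real.log y) ((Real.log x)⁻¹ - (Real.log x)⁻¹ ^ 2) x := by
  have hx0 : x ≠ 0 := ((Real.exp_pos 2).trans hx).ne'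
  have hl : Real.log x ≠ 0 := by linarith [two_lt_log_of_exp_two_lt hx]
  refine ((hasDerivAt_id x).div (Real.hasDerivAt_log hx0) hl).congr_deriv ?_
  simp only [id]
  field_simp

lemma concaveOn_div_log : ConcaveOn ℝ (Set.Ioi (Real.exp 2)) fun x => x / Real.log x := by
  refine AntitoneOn.concaveOn_of_deriv (convex_Ioi _)
    (fun x hx => (hasDerivAt_div_log hx).continuousAt.continuousWithinAt) ?_ ?_
  · rw [interior_Ioi]
    exact fun x hx => (hasDerivAt_div_log hx).differentiableAt.differentiableWithinAt
  · rw [interior_Ioi]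
    intro x hx y hy hxy
    rw [(hasDerivAt_div_log hx).deriv, (hasDerivAt_div_log hy).deriv]
    have hlx := two_lt_log_of_exp_two_lt hx
    have hly := two_lt_log_of_exp_two_lt hy
    have hle : (Real.log y)⁻¹ ≤ (Real.log x)⁻¹ :=
      inv_anti₀ (by linarith) (Real.log_le_log ((Real.exp_pos 2).trans hx) hxy)
    have hx2 : (Real.log x)⁻¹ ≤ 1 / 2 := by
      rw [inv_eq_one_div]; exact one_div_le_one_div_of_le two_pos hlx.le
    nlinarith

lemma concaveOn_sqrt_div_log :
    ConcaveOn ℝ (Set.Ioi (Real.exp 2)) fun x => √(x / Real.log x) := by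
  have hpos : ∀ x ∈ Set.Ioi (Real.exp 2), 0 ≤ x / Real.log x := fun x hx =>
    div_nonneg ((Real.exp_pos 2).trans hx).le (by linarith [two_lt_log_of_exp_two_lt hx])
  refine ⟨convex_Ioi _, fun x hx y hy a b ha hb hab => ?_⟩
  calc a • √(x / Real.log x) + b • √(y / Real.log y)
      ≤ √(a • (x / Real.log x) + b • (y / Real.log y)) :=
        Real.strictConcaveOn_sqrt.concaveOn.2 (hpos x hx) (hpos y hy) ha hb hab
    _ ≤ _ := Real.sqrt_le_sqrt (concaveOn_div_log.2 hx hy ha hb hab)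

/-- The tangent line of `x ↦ √(x / log x)` at `y` lies above the graph. -/
lemma sqrt_div_log_le_tangent {x y : ℝ} (hx : x ∈ Set.Ioi (Real.exp 2))
    (hy : y ∈ Set.Ioi (Real.exp 2)) :
    √(x / Real.log x) ≤ √(y / Real.log y) +
      √(y / Real.log y) / (2 * y) * (1 - (Real.log y)⁻¹) * (x - y) := by
  have hx0 : 0 < x := (Real.exp_pos 2).trans hx
  have hy0 : 0 < y := (Real.exp_pos 2).trans hy
  have hlx := two_lt_log_of_exp_two_lt hx
  have hly := two_lt_log_of_exp_two_lt hy
  have htan : x / Real.log x ≤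
      y / Real.log y + ((Real.log y)⁻¹ - (Real.log y)⁻¹ ^ 2) * (x - y) := by
    rcases lt_trichotomy x y with h | rfl | h
    · have := concaveOn_div_log.le_slope_of_hasDerivAt hx hy h (hasDerivAt_div_log hy)
      rw [slope_def_field, le_div_iff₀ (by linarith)] at this
      linarith
    · simp
    · have := concaveOn_div_log.slope_le_of_hasDerivAt hy hx h (hasDerivAt_div_log hy)
      rw [slope_def_field, div_le_iff₀ (by linarith)] at this
      linarith
  set u := √(x / Real.log x)
  set v := √(y / Real.log y)
  have hu : u ^ 2 = x / Real.log x := Real.sq_sqrt (div_nonneg hx0.le (by linarith))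
  have hv : v ^ 2 = y / Real.log y := Real.sq_sqrt (div_nonneg hy0.le (by linarith))
  have hv0 : 0 < v := Real.sqrt_pos.2 (div_pos hy0 (by linarith))
  have hlv : (Real.log y)⁻¹ = v ^ 2 / y := by rw [hv]; field_simp
  rw [← hu, ← hv] at htan
  have hkey : 2 * v * u ≤ 2 * v * (v + v / (2 * y) * (1 - (Real.log y)⁻¹) * (x - y)) := by
    have : 2 * v * (v + v / (2 * y) * (1 - (Real.log y)⁻¹) * (x - y)) =
        2 * v ^ 2 + ((Real.log y)⁻¹ - (Real.log y)⁻¹ ^ 2) * (x - y) := by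
      rw [hlv]; field_simp
    nlinarith [sq_nonneg (u - v)]
  exact le_of_mul_le_mul_left hkey (by positivity)

lemma Gamma_natCast_sub_eq_prod {r n : ℕ} (h : r + 1 ≤ n) {x : ℝ} (hx : x < r + 1) :
    Real.Gamma (n - x) =
      Real.Gamma (r - x + 1) * ∏ i ∈ Finset.Ico (r + 1) n, ((i : ℝ) - x) := by
  induction n, h using Nat.le_induction with
  | base => simp; ring_nf
  | succ n hn ih =>
    have hn' : (r : ℝ) + 1 ≤ n := by exact_mod_cast hn
    rw [Finset.prod_Ico_succ_top hn, ← mul_assoc, ← ih, Nat.cast_succ,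
      show (n : ℝ) + 1 - x = (n - x) + 1 by ring, Real.Gamma_add_one (by linarith), mul_comm]

lemma Gamma_ratio_eq_prod {r n : ℕ} (hr : 1 ≤ r) (h : r + 1 ≤ n) {x : ℝ} (hx : x < r + 1) :
    Real.Gamma r / Real.Gamma (r - x + 1) * (Real.Gamma (n - x) / Real.Gamma n) =
      (r : ℝ)⁻¹ * ∏ i ∈ Finset.Ico (r + 1) n, (1 - x / i) := by
  have hr0 : (0 : ℝ) < r := by exact_mod_cast hr
  have hG : Real.Gamma (r - x + 1) ≠ 0 := (Real.Gamma_pos_of_pos (by linarith)).ne'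
  have hGr : Real.Gamma r ≠ 0 := (Real.Gamma_pos_of_pos hr0).ne'
  have hi : ∀ i ∈ Finset.Ico (r + 1) n, (i : ℝ) ≠ 0 := fun i hi => by
    have := (Finset.mem_Ico.1 hi).1
    exact_mod_cast (by omega : i ≠ 0)
  have h0 := Gamma_natCast_sub_eq_prod h (x := 0) (by linarith)
  simp only [sub_zero] at h0
  rw [Real.Gamma_add_one hr0.ne'] at h0
  have hprod : ∏ i ∈ Finset.Ico (r + 1) n, (1 - x / i) =
      (∏ i ∈ Finset.Ico (r + 1) n, ((i : ℝ) - x)) / ∏ i ∈ Finset.Ico (r + 1) n, (i : ℝ) := by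
    rw [← Finset.prod_div_distrib]
    exact Finset.prod_congr rfl fun i hi' => by field_simp [hi i hi']
  have hp : ∏ i ∈ Finset.Ico (r + 1) n, (i : ℝ) ≠ 0 := Finset.prod_ne_zero_iff.2 hi
  rw [Gamma_natCast_sub_eq_prod h hx, h0, hprod]
  field_simp

lemma sum_inv_Ico_le {r n : ℕ} (hr : 1 ≤ r) (h : r + 1 ≤ n) :
    ∑ i ∈ Finset.Ico (r + 1) n, (i : ℝ)⁻¹ ≤ Real.log (n - 1) - Real.log r := by
  induction n, h using Nat.le_induction with
  | base => simp
  | succ n hn ih =>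
    have hn' : (r : ℝ) + 1 ≤ n := by exact_mod_cast hn
    have hr' : (1 : ℝ) ≤ r := by exact_mod_cast hr
    rw [Finset.sum_Ico_succ_top hn, Nat.cast_succ, add_sub_cancel_right]
    have h1 := Real.one_sub_inv_le_log_of_pos (x := n / (n - 1)) (by
      apply div_pos <;> linarith)
    have hn0 : (n : ℝ) ≠ 0 := by linarith
    rw [Real.log_div (by linarith) (by linarith), inv_div,
      show 1 - ((n : ℝ) - 1) / n = (n : ℝ)⁻¹ by field_simp; ring] at h1
    linarith

lemma le_sum_inv_Ico {r n : ℕ} (h : r + 1 ≤ n) :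
    Real.log n - Real.log (r + 1) ≤ ∑ i ∈ Finset.Ico (r + 1) n, (i : ℝ)⁻¹ := by
  induction n, h using Nat.le_induction with
  | base => simp
  | succ n hn ih =>
    have hn' : (0 : ℝ) < n := by exact_mod_cast (by omega : 0 < n)
    rw [Finset.sum_Ico_succ_top hn, Nat.cast_succ]
    have h1 := Real.log_le_sub_one_of_pos (x := (n + 1) / n) (by positivity)
    rw [Real.log_div (by linarith) (by linarith),
      show ((n : ℝ) + 1) / n - 1 = (n : ℝ)⁻¹ by field_simp; ring] at h1
    linarith

lemma sum_inv_sq_Ico_le {r n : ℕ} (hr : 1 ≤ r) (h : r + 1 ≤ n) :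
    ∑ i ∈ Finset.Ico (r + 1) n, ((i : ℝ) ^ 2)⁻¹ ≤ (r : ℝ)⁻¹ - ((n : ℝ) - 1)⁻¹ := by
  induction n, h using Nat.le_induction with
  | base => simp
  | succ n hn ih =>
    have hn' : (r : ℝ) + 1 ≤ n := by exact_mod_cast hn
    have hr' : (1 : ℝ) ≤ r := by exact_mod_cast hr
    rw [Finset.sum_Ico_succ_top hn, Nat.cast_succ, add_sub_cancel_right]
    have h1 : (0 : ℝ) < n - 1 := by linarith
    have h2 : (0 : ℝ) < n := by linarith
    have : ((n : ℝ) ^ 2)⁻¹ ≤ ((n : ℝ) - 1)⁻¹ - (n : ℝ)⁻¹ := by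
      rw [show ((n : ℝ) - 1)⁻¹ - (n : ℝ)⁻¹ = (((n : ℝ) - 1) * n)⁻¹ by field_simp; ring]
      exact inv_anti₀ (by positivity) (by nlinarith)
    linarith

lemma le_sum_inv_sq_Ico {r n : ℕ} (h : r + 1 ≤ n) :
    ((r : ℝ) + 1)⁻¹ - (n : ℝ)⁻¹ ≤ ∑ i ∈ Finset.Ico (r + 1) n, ((i : ℝ) ^ 2)⁻¹ := by
  induction n, h using Nat.le_induction with
  | base => simp
  | succ n hn ih =>
    have h2 : (0 : ℝ) < n := by exact_mod_cast (by omega : 0 < n)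
    rw [Finset.sum_Ico_succ_top hn, Nat.cast_succ]
    have : (n : ℝ)⁻¹ - ((n : ℝ) + 1)⁻¹ ≤ ((n : ℝ) ^ 2)⁻¹ := by
      rw [show (n : ℝ)⁻¹ - ((n : ℝ) + 1)⁻¹ = ((n : ℝ) * (n + 1))⁻¹ by field_simp; ring]
      exact inv_anti₀ (by positivity) (by nlinarith)
    linarith

lemma log_one_sub_le {y : ℝ} (h0 : 0 ≤ y) (h1 : y < 1) :
    Real.log (1 - y) ≤ -y - y ^ 2 / 2 := by
  have h := sum_le_hasSum (Finset.range 2) (fun i _ => by positivity)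
    (Real.hasSum_pow_div_log_of_abs_lt_one (by rwa [abs_of_nonneg h0]))
  norm_num [Finset.sum_range_succ] at h
  linarith

lemma le_log_one_sub {y : ℝ} (h0 : 0 ≤ y) (h1 : y ≤ 1 / 2) :
    -y - y ^ 2 / 2 - 2 * y ^ 3 ≤ Real.log (1 - y) := by
  have h := (abs_le.1 (Real.abs_log_sub_add_sum_range_le (x := y)
    (by rw [abs_of_nonneg h0]; linarith) 2)).1
  rw [abs_of_nonneg h0] at h
  norm_num [Finset.sum_range_succ] at h
  have : y ^ 3 / (1 - y) ≤ 2 * y ^ 3 := by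
    rw [div_le_iff₀ (by linarith)]
    nlinarith [pow_nonneg h0 3]
  linarith

/-- The logarithm of `φ_{n,ε}` on `(0, r)`, for `n = k r`. -/
def logPhi (β : ℝ) (k r : ℕ) (x : ℝ) : ℝ :=
  Real.log x - Real.log (((k * r : ℕ) : ℝ) / (k - 1)) + x * Real.log k +
    ∑ i ∈ Finset.Ico (r + 1) (k * r), Real.log (1 - x / i) + β * √(x / Real.log x)

lemma one_sub_div_pos_of_mem_Ico {r n i : ℕ} (hi : i ∈ Finset.Ico (r + 1) n) {x : ℝ}
    (hx : x < r) : 0 < 1 - x / i := by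
  have h1 : (r : ℝ) + 1 ≤ i := by exact_mod_cast (Finset.mem_Ico.1 hi).1
  have h2 : (0 : ℝ) < i := by
    have : (0 : ℝ) ≤ r := by positivity
    linarith
  rw [sub_pos, div_lt_one h2]
  linarith

lemma phi_eq_exp_logPhi (β : ℝ) {k r : ℕ} (hk : 2 ≤ k) (hr : 2 ≤ r) {x : ℝ} (hx0 : 0 < x)
    (hx : x < r) :
    ((k : ℝ) - 1) * x * (k : ℝ) ^ (x - 1) *
        (Real.Gamma (r : ℝ) / Real.Gamma ((r : ℝ) - x + 1)) *
        (Real.Gamma (((k * r : ℕ) : ℝ) - x) / Real.Gamma ((k * r : ℕ) : ℝ)) *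
        Real.exp (β * √(x / Real.log x)) = Real.exp (logPhi β k r x) := by
  have hk' : (2 : ℝ) ≤ k := by exact_mod_cast hk
  have hk0 : (0 : ℝ) < k := by linarith
  have hk1 : (0 : ℝ) < k - 1 := by linarith
  have hr' : (2 : ℝ) ≤ r := by exact_mod_cast hr
  have hr0 : (0 : ℝ) < r := by linarith
  have hn : r + 1 ≤ k * r := by nlinarith
  have hsum : Real.exp (∑ i ∈ Finset.Ico (r + 1) (k * r), Real.log (1 - x / i)) =
      ∏ i ∈ Finset.Ico (r + 1) (k * r), (1 - x / i) := by
    rw [Real.exp_sum]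
    exact Finset.prod_congr rfl fun i hi => Real.exp_log (one_sub_div_pos_of_mem_Ico hi hx)
  have hN : (0 : ℝ) < ((k * r : ℕ) : ℝ) / (k - 1) := by push_cast; positivity
  rw [logPhi, Real.exp_add, Real.exp_add, Real.exp_add, Real.exp_sub, hsum, Real.exp_log hx0,
    Real.exp_log hN, mul_comm x (Real.log k), ← Real.rpow_def_of_pos hk0,
    mul_assoc (((k : ℝ) - 1) * x * (k : ℝ) ^ (x - 1)),
    Gamma_ratio_eq_prod (by omega) hn (by linarith), Real.rpow_sub hk0, Real.rpow_one]
  push_cast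
  field_simp

lemma strictConcaveOn_logPhi {β : ℝ} (hβ : 0 ≤ β) (k r : ℕ) :
    StrictConcaveOn ℝ (Set.Ioo (Real.exp 2) r) (logPhi β k r) := by
  have hconv : Convex ℝ (Set.Ioo (Real.exp 2) (r : ℝ)) := convex_Ioo _ _
  have hlog : StrictConcaveOn ℝ (Set.Ioo (Real.exp 2) (r : ℝ)) Real.log :=
    strictConcaveOn_log_Ioi.subset (fun x hx => (Real.exp_pos 2).trans hx.1) hconv
  have hsqrt : ConcaveOn ℝ (Set.Ioo (Real.exp 2) (r : ℝ)) fun x => β * √(x / Real.log x) :=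
    (concaveOn_sqrt_div_log.subset Set.Ioo_subset_Ioi_self hconv).smul hβ
  have hlin : ConcaveOn ℝ (Set.Ioo (Real.exp 2) (r : ℝ)) fun x => x * Real.log k :=
    ⟨hconv, fun x _ y _ a b _ _ _ => by simp only [smul_eq_mul]; apply le_of_eq; ring⟩
  have hterm : ∀ i ∈ Finset.Ico (r + 1) (k * r),
      ConcaveOn ℝ (Set.Ioo (Real.exp 2) (r : ℝ)) fun x => Real.log (1 - x / i) := by
    intro i hi
    refine ⟨hconv, fun x hx y hy a b ha hb hab => ?_⟩
    refine (strictConcaveOn_log_Ioi.concaveOn.2 (one_sub_div_pos_of_mem_Ico hi hx.2)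
      (one_sub_div_pos_of_mem_Ico hi hy.2) ha hb hab).trans_eq ?_
    congr 1
    simp only [smul_eq_mul]
    linear_combination hab
  have hsum : ConcaveOn ℝ (Set.Ioo (Real.exp 2) (r : ℝ)) fun x =>
      ∑ i ∈ Finset.Ico (r + 1) (k * r), Real.log (1 - x / i) := by
    refine ⟨hconv, fun x hx y hy a b ha hb hab => ?_⟩
    rw [Finset.smul_sum, Finset.smul_sum, ← Finset.sum_add_distrib]
    exact Finset.sum_le_sum fun i hi => (hterm i hi).2 hx hy ha hb hab
  exact (((hlog.add_concaveOn (concaveOn_const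
    (-Real.log (((k * r : ℕ) : ℝ) / (k - 1))) hconv)).add_concaveOn hlin).add_concaveOn
      hsum).add_concaveOn hsqrt

lemma logPhi_le (β : ℝ) {k r : ℕ} (hk : 2 ≤ k) (hr : 2 ≤ r) {x : ℝ} (hx0 : 0 < x)
    (hx : x < r) :
    logPhi β k r x ≤
      3 / 2 - x ^ 2 / (2 * (((k * r : ℕ) : ℝ) / (k - 1))) + β * √(x / Real.log x) := by
  have hk' : (2 : ℝ) ≤ k := by exact_mod_cast hk
  have hr' : (2 : ℝ) ≤ r := by exact_mod_cast hr
  have hr0 : (0 : ℝ) < r := by linarith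
  have hk1 : (0 : ℝ) < k - 1 := by linarith
  have hk0 : (0 : ℝ) < k := by linarith
  have hn : r + 1 ≤ k * r := by nlinarith
  have hN : Real.log x ≤ Real.log (((k * r : ℕ) : ℝ) / (k - 1)) := by
    refine Real.log_le_log hx0 (hx.le.trans ?_)
    rw [le_div_iff₀ hk1]
    push_cast
    nlinarith
  have hsum : ∑ i ∈ Finset.Ico (r + 1) (k * r), Real.log (1 - x / i) ≤
      -x * ∑ i ∈ Finset.Ico (r + 1) (k * r), (i : ℝ)⁻¹ -
        x ^ 2 / 2 * ∑ i ∈ Finset.Ico (r + 1) (k * r), ((i : ℝ) ^ 2)⁻¹ := by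
    rw [Finset.mul_sum, Finset.mul_sum, ← Finset.sum_sub_distrib]
    refine Finset.sum_le_sum fun i hi => ?_
    have hpos := one_sub_div_pos_of_mem_Ico hi hx
    refine (log_one_sub_le (by positivity) (by linarith)).trans_eq ?_
    field_simp
  have h1 : Real.log k - (r : ℝ)⁻¹ ≤ ∑ i ∈ Finset.Ico (r + 1) (k * r), (i : ℝ)⁻¹ := by
    refine le_trans ?_ (le_sum_inv_Ico hn)
    have h := Real.log_le_sub_one_of_pos (x := ((r : ℝ) + 1) / r) (by positivity)
    rw [Real.log_div (by linarith) (by linarith),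
      show ((r : ℝ) + 1) / r - 1 = (r : ℝ)⁻¹ by field_simp; ring] at h
    push_cast
    rw [Real.log_mul hk0.ne' hr0.ne']
    linarith
  have h2 : (((k * r : ℕ) : ℝ) / (k - 1))⁻¹ - ((r : ℝ) ^ 2)⁻¹ ≤
      ∑ i ∈ Finset.Ico (r + 1) (k * r), ((i : ℝ) ^ 2)⁻¹ := by
    refine le_trans ?_ (le_sum_inv_sq_Ico hn)
    have h : (r : ℝ)⁻¹ - ((r : ℝ) ^ 2)⁻¹ ≤ ((r : ℝ) + 1)⁻¹ := by
      rw [show (r : ℝ)⁻¹ - ((r : ℝ) ^ 2)⁻¹ = (r - 1) / r ^ 2 by field_simp,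
        inv_eq_one_div, div_le_div_iff₀ (by positivity) (by positivity)]
      nlinarith
    have h' : (((k * r : ℕ) : ℝ) / (k - 1))⁻¹ = (r : ℝ)⁻¹ - (((k * r : ℕ) : ℝ))⁻¹ := by
      push_cast
      field_simp
    linarith
  have h3 : x * (r : ℝ)⁻¹ ≤ 1 := by
    rw [← div_eq_mul_inv, div_le_one hr0]; exact hx.le
  have h4 : x ^ 2 / 2 * ((r : ℝ) ^ 2)⁻¹ ≤ 1 / 2 := by
    have : x ^ 2 / 2 * ((r : ℝ) ^ 2)⁻¹ = (x * (r : ℝ)⁻¹) ^ 2 / 2 := by field_simp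
    rw [this]
    have : 0 ≤ x * (r : ℝ)⁻¹ := by positivity
    nlinarith
  have h5 := mul_le_mul_of_nonneg_left h1 hx0.le
  have h6 := mul_le_mul_of_nonneg_left h2 (by positivity : 0 ≤ x ^ 2 / 2)
  have h7 : x ^ 2 / (2 * (((k * r : ℕ) : ℝ) / (k - 1))) =
      x ^ 2 / 2 * (((k * r : ℕ) : ℝ) / (k - 1))⁻¹ := by
    rw [← div_div, div_eq_mul_inv (x ^ 2 / 2)]
  rw [logPhi, h7]
  linarith

lemma le_logPhi (β : ℝ) {k r : ℕ} (hk : 2 ≤ k) (hr : 2 ≤ r) {x : ℝ} (hx0 : 0 < x)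
    (hx : x ≤ r / 2) :
    Real.log x - Real.log (((k * r : ℕ) : ℝ) / (k - 1)) -
        x ^ 2 / (2 * (((k * r : ℕ) : ℝ) / (k - 1))) - 2 * x ^ 3 / (r : ℝ) ^ 2 +
        β * √(x / Real.log x) ≤ logPhi β k r x := by
  have hk' : (2 : ℝ) ≤ k := by exact_mod_cast hk
  have hr' : (2 : ℝ) ≤ r := by exact_mod_cast hr
  have hr0 : (0 : ℝ) < r := by linarith
  have hk1 : (0 : ℝ) < k - 1 := by linarith
  have hk0 : (0 : ℝ) < k := by linarith
  have hn : r + 1 ≤ k * r := by nlinarith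
  have hn' : (r : ℝ) + 1 ≤ ((k * r : ℕ) : ℝ) := by exact_mod_cast hn
  have hsum : -x * ∑ i ∈ Finset.Ico (r + 1) (k * r), (i : ℝ)⁻¹ -
        x ^ 2 / 2 * ∑ i ∈ Finset.Ico (r + 1) (k * r), ((i : ℝ) ^ 2)⁻¹ -
        2 * x ^ 3 / r * ∑ i ∈ Finset.Ico (r + 1) (k * r), ((i : ℝ) ^ 2)⁻¹ ≤
      ∑ i ∈ Finset.Ico (r + 1) (k * r), Real.log (1 - x / i) := by
    rw [Finset.mul_sum, Finset.mul_sum, Finset.mul_sum, ← Finset.sum_sub_distrib,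
      ← Finset.sum_sub_distrib]
    refine Finset.sum_le_sum fun i hi => ?_
    have hi' : (r : ℝ) + 1 ≤ i := by exact_mod_cast (Finset.mem_Ico.1 hi).1
    have hi0 : (0 : ℝ) < i := by linarith
    refine le_trans ?_ (le_log_one_sub (y := x / i) (by positivity) ?_)
    · have h : 2 * (x / i) ^ 3 ≤ 2 * x ^ 3 / r * ((i : ℝ) ^ 2)⁻¹ := by
        rw [show 2 * (x / i) ^ 3 = 2 * x ^ 3 / i * ((i : ℝ) ^ 2)⁻¹ by field_simp]
        have : (r : ℝ) ≤ i := by linarith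
        gcongr
      have h' : -x * (i : ℝ)⁻¹ - x ^ 2 / 2 * ((i : ℝ) ^ 2)⁻¹ = -(x / i) - (x / i) ^ 2 / 2 := by
        field_simp
      linarith
    · rw [div_le_iff₀ hi0]; linarith
  have h1 : ∑ i ∈ Finset.Ico (r + 1) (k * r), (i : ℝ)⁻¹ ≤ Real.log k := by
    refine (sum_inv_Ico_le (by omega) hn).trans ?_
    have : Real.log (((k * r : ℕ) : ℝ) - 1) ≤ Real.log ((k * r : ℕ) : ℝ) :=
      Real.log_le_log (by linarith) (by linarith)
    rw [Nat.cast_mul, Real.log_mul hk0.ne' hr0.ne'] at this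
    push_cast
    linarith
  have h2 := sum_inv_sq_Ico_le (by omega) hn
  have h3 : (((k * r : ℕ) : ℝ))⁻¹ ≤ (((k * r : ℕ) : ℝ) - 1)⁻¹ :=
    inv_anti₀ (by linarith) (by linarith)
  have h4 : (((k * r : ℕ) : ℝ) / (k - 1))⁻¹ = (r : ℝ)⁻¹ - (((k * r : ℕ) : ℝ))⁻¹ := by
    push_cast
    field_simp
  have h5 : 0 ≤ (((k * r : ℕ) : ℝ))⁻¹ := by positivity
  have h6 := mul_le_mul_of_nonneg_left h1 hx0.le
  have h7 : ∑ i ∈ Finset.Ico (r + 1) (k * r), ((i : ℝ) ^ 2)⁻¹ ≤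
      (((k * r : ℕ) : ℝ) / (k - 1))⁻¹ := by linarith
  have h8 : ∑ i ∈ Finset.Ico (r + 1) (k * r), ((i : ℝ) ^ 2)⁻¹ ≤ (r : ℝ)⁻¹ := by linarith
  have h9 := mul_le_mul_of_nonneg_left h7 (by positivity : 0 ≤ x ^ 2 / 2)
  have h10 := mul_le_mul_of_nonneg_left h8 (by positivity : 0 ≤ 2 * x ^ 3 / r)
  have h11 : x ^ 2 / (2 * (((k * r : ℕ) : ℝ) / (k - 1))) =
      x ^ 2 / 2 * (((k * r : ℕ) : ℝ) / (k - 1))⁻¹ := by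
    rw [← div_div, div_eq_mul_inv (x ^ 2 / 2)]
  have h12 : 2 * x ^ 3 / (r : ℝ) ^ 2 = 2 * x ^ 3 / r * (r : ℝ)⁻¹ := by field_simp
  rw [logPhi, h11, h12]
  linarith

/-- The approximate location `(κ N² / log N)^(1/3)` of the maximum of `φ_{n,ε}`. -/
def saddle (κ N : ℝ) : ℝ := (κ * N ^ 2 / Real.log N) ^ ((1 : ℝ) / 3)

lemma saddle_pow_three {κ N : ℝ} (hκ : 0 < κ) (hN : 1 < N) :
    saddle κ N ^ 3 = κ * N ^ 2 / Real.log N := by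
  have hL : 0 < Real.log N := Real.log_pos hN
  rw [saddle, ← Real.rpow_natCast, ← Real.rpow_mul (by positivity)]
  norm_num

lemma saddle_pos {κ N : ℝ} (hκ : 0 < κ) (hN : 1 < N) : 0 < saddle κ N := by
  have hL : 0 < Real.log N := Real.log_pos hN
  exact Real.rpow_pos_of_pos (by positivity) _

lemma tendsto_div_log_pow_atTop (m : ℕ) :
    Tendsto (fun N : ℝ => N / Real.log N ^ m) atTop atTop := by
  have h : Tendsto (fun N : ℝ => Real.log N ^ m / N) atTop (nhdsWithin 0 (Set.Ioi 0)) := by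
    refine tendsto_nhdsWithin_iff.2 ⟨Real.isLittleO_pow_log_id_atTop.tendsto_div_nhds_zero, ?_⟩
    filter_upwards [eventually_gt_atTop 1] with N hN
    have hL : 0 < Real.log N := Real.log_pos hN
    exact Set.mem_Ioi.2 (by positivity)
  refine h.inv_tendsto_nhdsGT_zero.congr fun N => ?_
  simp

lemma tendsto_saddle_atTop {κ : ℝ} (hκ : 0 < κ) : Tendsto (saddle κ) atTop atTop := by
  have h : Tendsto (fun N : ℝ => κ * N ^ 2 / Real.log N) atTop atTop := by
    refine ((tendsto_id.const_mul_atTop hκ).atTop_mul_atTop₀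
      (tendsto_div_log_pow_atTop 1)).congr fun N => ?_
    simp only [id]
    ring
  exact (tendsto_rpow_atTop (by norm_num)).comp h

lemma tendsto_saddle_div_self {κ : ℝ} (hκ : 0 < κ) :
    Tendsto (fun N => saddle κ N / N) atTop (nhds 0) := by
  have h : Tendsto (fun N : ℝ => κ * (N⁻¹ * (Real.log N)⁻¹)) atTop (nhds 0) := by
    simpa using (tendsto_inv_atTop_zero.mul
      (tendsto_inv_atTop_zero.comp Real.tendsto_log_atTop)).const_mul κ
  have h' := h.rpow_const (p := (1 : ℝ) / 3) (Or.inr (by norm_num))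
  rw [Real.zero_rpow (by norm_num)] at h'
  refine h'.congr' ?_
  filter_upwards [eventually_gt_atTop 1] with N hN
  have hL : 0 < Real.log N := Real.log_pos hN
  have hN0 : 0 < N := by linarith
  have hs := saddle_pos hκ hN
  refine (pow_left_inj₀ (by positivity) (by positivity) three_ne_zero).1 ?_
  rw [div_pow, saddle_pow_three hκ hN, ← Real.rpow_natCast, ← Real.rpow_mul (by positivity)]
  norm_num
  field_simp

lemma tendsto_log_saddle_div_log {κ : ℝ} (hκ : 0 < κ) :
    Tendsto (fun N => Real.log (saddle κ N) / Real.log N) atTop (nhds (2 / 3)) := by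
  have h1 : Tendsto (fun N => Real.log κ / Real.log N) atTop (nhds 0) :=
    Real.tendsto_log_atTop.const_div_atTop _
  have h2 : Tendsto (fun N => Real.log (Real.log N) / Real.log N) atTop (nhds 0) :=
    Real.isLittleO_log_id_atTop.tendsto_div_nhds_zero.comp Real.tendsto_log_atTop
  have h := ((h1.add_const 2).sub h2).div_const 3
  rw [show ((0 : ℝ) + 2 - 0) / 3 = 2 / 3 by norm_num] at h
  refine h.congr' ?_
  filter_upwards [eventually_gt_atTop 1] with N hN
  have hL : 0 < Real.log N := Real.log_pos hN
  have hN0 : 0 < N := by linarith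
  rw [saddle, Real.log_rpow (by positivity), Real.log_div (by positivity) hL.ne',
    Real.log_mul hκ.ne' (by positivity), Real.log_pow]
  push_cast
  field_simp

lemma saddle_sq_div_eq {κ N : ℝ} (hκ : 0 < κ) (hN : 1 < N) :
    saddle κ N ^ 2 / N = (κ ^ 2 * N / Real.log N ^ 2) ^ ((1 : ℝ) / 3) := by
  have hL : 0 < Real.log N := Real.log_pos hN
  have hN0 : 0 < N := by linarith
  have hs := saddle_pos hκ hN
  refine (pow_left_inj₀ (by positivity) (by positivity) three_ne_zero).1 ?_
  rw [← Real.rpow_natCast ((κ ^ 2 * N / Real.log N ^ 2) ^ _), ← Real.rpow_mul (by positivity),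
    div_pow, ← pow_mul, mul_comm 2 3, pow_mul, saddle_pow_three hκ hN]
  norm_num
  field_simp

lemma tendsto_saddle_sq_div_div_log {κ : ℝ} (hκ : 0 < κ) :
    Tendsto (fun N => saddle κ N ^ 2 / N / Real.log N) atTop atTop := by
  have h := (tendsto_rpow_atTop (y := (1 : ℝ) / 3) (by norm_num)).comp
    ((tendsto_div_log_pow_atTop 5).const_mul_atTop (by positivity : 0 < κ ^ 2))
  refine h.congr' ?_
  filter_upwards [eventually_gt_atTop 1] with N hN
  have hL : 0 < Real.log N := Real.log_pos hN
  have hN0 : 0 < N := by linarith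
  simp only [Function.comp]
  rw [saddle_sq_div_eq hκ hN]
  refine (pow_left_inj₀ (by positivity) (by positivity) three_ne_zero).1 ?_
  rw [div_pow, ← Real.rpow_natCast, ← Real.rpow_mul (by positivity), ← Real.rpow_natCast (_ ^ _),
    ← Real.rpow_mul (by positivity)]
  norm_num
  field_simp

lemma tendsto_saddle_sq_div {κ : ℝ} (hκ : 0 < κ) :
    Tendsto (fun N => saddle κ N ^ 2 / N) atTop atTop := by
  refine ((tendsto_saddle_sq_div_div_log hκ).atTop_mul_atTop₀ Real.tendsto_log_atTop).congr' ?_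
  filter_upwards [eventually_gt_atTop 1] with N hN
  exact div_mul_cancel₀ _ (Real.log_pos hN).ne'

/-- The value at the saddle of `β √(x / log x)`, relative to the scale `x² / N`. -/
def saddleRatio (β κ N : ℝ) : ℝ :=
  β * √(saddle κ N / Real.log (saddle κ N)) / (saddle κ N ^ 2 / N)

lemma tendsto_saddleRatio {β κ : ℝ} (hβ : 0 < β) (hκ : κ = 3 * β ^ 2 / 8) :
    Tendsto (saddleRatio β κ) atTop (nhds 2) := by
  have hκ0 : 0 < κ := by rw [hκ]; positivity
  have h := (((tendsto_log_saddle_div_log hκ0).inv₀ (by norm_num)).div_const κ).sqrt.const_mul β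
  have hlim : β * √((2 / 3 : ℝ)⁻¹ / κ) = 2 := by
    rw [hκ, show (2 / 3 : ℝ)⁻¹ / (3 * β ^ 2 / 8) = (2 / β) ^ 2 by field_simp; norm_num,
      Real.sqrt_sq (by positivity)]
    field_simp
  rw [hlim] at h
  refine h.congr' ?_
  filter_upwards [eventually_gt_atTop 1, (tendsto_saddle_atTop hκ0).eventually_gt_atTop 1]
    with N hN hs1
  have hL : 0 < Real.log N := Real.log_pos hN
  have hl : 0 < Real.log (saddle κ N) := Real.log_pos hs1
  have hN0 : 0 < N := by linarith
  have hs : 0 < saddle κ N := by linarith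
  have hQ : 0 < saddle κ N ^ 2 / N := by positivity
  rw [saddleRatio, mul_div_assoc]
  congr 1
  rw [← Real.sqrt_sq hQ.le, ← Real.sqrt_div' _ (by positivity)]
  congr 1
  have h3 := saddle_pow_three hκ0 hN
  have h3' : saddle κ N ^ 3 * Real.log N = κ * N ^ 2 := by rw [h3]; field_simp
  field_simp
  linear_combination h3'

/-- The asymptotic lower bound for the maximum of `log φ_{n,ε}`, relative to `x² / N`. -/
def relLower (β κ N : ℝ) : ℝ :=
  saddleRatio β κ N - 1 / 2 - Real.log N / (saddle κ N ^ 2 / N) -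
    8 * κ / Real.log N / (saddle κ N ^ 2 / N)

/-- The asymptotic upper bound for the maximum of `log φ_{n,ε}`, relative to `x² / N`. -/
def relUpper (β κ N : ℝ) : ℝ :=
  3 / 2 / (saddle κ N ^ 2 / N) + saddleRatio β κ N -
    saddleRatio β κ N / 2 * (1 - (Real.log (saddle κ N))⁻¹) +
    (saddleRatio β κ N * (1 - (Real.log (saddle κ N))⁻¹)) ^ 2 / 8

lemma tendsto_relLower {β κ : ℝ} (hβ : 0 < β) (hκ : κ = 3 * β ^ 2 / 8) :
    Tendsto (relLower β κ) atTop (nhds (3 / 2)) := by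
  have hκ0 : 0 < κ := by rw [hκ]; positivity
  have h1 : Tendsto (fun N => Real.log N / (saddle κ N ^ 2 / N)) atTop (nhds 0) := by
    refine (tendsto_inv_atTop_zero.comp (tendsto_saddle_sq_div_div_log hκ0)).congr fun N => ?_
    simp only [Function.comp, inv_div]
  have h2 : Tendsto (fun N => 8 * κ / Real.log N / (saddle κ N ^ 2 / N)) atTop (nhds 0) :=
    (Real.tendsto_log_atTop.const_div_atTop _).div_atTop (tendsto_saddle_sq_div hκ0)
  have h := (((tendsto_saddleRatio hβ hκ).sub_const (1 / 2)).sub h1).sub h2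
  rwa [show (2 : ℝ) - 1 / 2 - 0 - 0 = 3 / 2 by norm_num] at h

lemma tendsto_relUpper {β κ : ℝ} (hβ : 0 < β) (hκ : κ = 3 * β ^ 2 / 8) :
    Tendsto (relUpper β κ) atTop (nhds (3 / 2)) := by
  have hκ0 : 0 < κ := by rw [hκ]; positivity
  have h1 : Tendsto (fun N => 3 / 2 / (saddle κ N ^ 2 / N)) atTop (nhds 0) :=
    (tendsto_saddle_sq_div hκ0).const_div_atTop _
  have h2 : Tendsto (fun N => 1 - (Real.log (saddle κ N))⁻¹) atTop (nhds (1 - 0)) :=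
    (tendsto_inv_atTop_zero.comp
      (Real.tendsto_log_atTop.comp (tendsto_saddle_atTop hκ0))).const_sub 1
  have hρ := tendsto_saddleRatio hβ hκ
  have h := ((h1.add hρ).sub ((hρ.div_const 2).mul h2)).add (((hρ.mul h2).pow 2).div_const 8)
  rwa [show (0 : ℝ) + 2 - 2 / 2 * (1 - 0) + (2 * (1 - 0)) ^ 2 / 8 = 3 / 2 by norm_num] at h

lemma neg_sq_div_add_sqrt_le {β κ N x : ℝ} (hβ : 0 < β) (hκ : 0 < κ) (hN : 1 < N)
    (hs : saddle κ N ∈ Set.Ioi (Real.exp 2)) (hx : x ∈ Set.Ioi (Real.exp 2)) :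
    3 / 2 - x ^ 2 / (2 * N) + β * √(x / Real.log x) ≤
      relUpper β κ N * (saddle κ N ^ 2 / N) := by
  have hs0 : 0 < saddle κ N := saddle_pos hκ hN
  have hN0 : 0 < N := by linarith
  have ht := mul_le_mul_of_nonneg_left (sqrt_div_log_le_tangent hx hs) hβ.le
  set s := saddle κ N with hsdef
  set θ := 1 - (Real.log s)⁻¹ with hθ
  set h := √(s / Real.log s) with hh
  set m := β * h / (2 * s) * θ with hm
  have hsq : m * x - x ^ 2 / (2 * N) ≤ N * m ^ 2 / 2 := by
    have : N * m ^ 2 / 2 - (m * x - x ^ 2 / (2 * N)) = (x - N * m) ^ 2 / (2 * N) := by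
      field_simp; ring
    have : 0 ≤ (x - N * m) ^ 2 / (2 * N) := by positivity
    linarith
  have hU : relUpper β κ N * (s ^ 2 / N) = 3 / 2 + β * h - m * s + N * m ^ 2 / 2 := by
    rw [relUpper, saddleRatio, ← hsdef, ← hθ, ← hh, hm]
    field_simp
    ring
  have ht' : β * (h + h / (2 * s) * θ * (x - s)) = β * h + m * x - m * s := by
    rw [hm]; ring
  rw [hU]
  linarith

lemma StrictConcaveOn.exists_isMaxOn_Ioo {f : ℝ → ℝ} {c b a s d : ℝ}
    (hf : StrictConcaveOn ℝ (Set.Ioo c b) f) (ha : c < a) (has : a < s) (hsd : s < d)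
    (hd : d < b) (hfa : f a < f s) (hfd : f d < f s) :
    ∃ x ∈ Set.Ioo c b, IsMaxOn f (Set.Ioo c b) x := by
  have hsub : Set.Icc a d ⊆ Set.Ioo c b := fun y hy => ⟨ha.trans_le hy.1, hy.2.trans_lt hd⟩
  have hcont : ContinuousOn f (Set.Icc a d) :=
    (hf.concaveOn.continuousOn isOpen_Ioo).mono hsub
  obtain ⟨x, hx, hmax⟩ := isCompact_Icc.exists_isMaxOn
    (Set.nonempty_Icc.2 (has.trans hsd).le) hcont
  have hsx : f s ≤ f x := hmax ⟨has.le, hsd.le⟩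
  have hxa : a < x := lt_of_le_of_ne hx.1 (by rintro rfl; linarith)
  have hxd : x < d := lt_of_le_of_ne hx.2 (by rintro rfl; linarith)
  refine ⟨x, hsub hx, IsMaxOn.of_isLocalMaxOn_of_concaveOn (hsub hx) ?_ hf.concaveOn⟩
  have hloc : IsLocalMax f x := hmax.isLocalMax (Icc_mem_nhds hxa hxd)
  exact hloc.on _

/-- For `n = k r`, the quotient `n / (k - 1)` is between `r` and `2 r`. -/
lemma le_mul_div_sub_one_and_le {k r : ℕ} (hk : 2 ≤ k) :
    (r : ℝ) ≤ ((k * r : ℕ) : ℝ) / (k - 1) ∧ ((k * r : ℕ) : ℝ) / (k - 1) ≤ 2 * r := by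
  have hk' : (2 : ℝ) ≤ k := by exact_mod_cast hk
  have hk1 : (0 : ℝ) < k - 1 := by linarith
  have hr0 : (0 : ℝ) ≤ r := by positivity
  rw [le_div_iff₀ hk1, div_le_iff₀ hk1]
  push_cast
  constructor <;> nlinarith

lemma relLower_mul_le_logPhi {β κ : ℝ} (hκ : 0 < κ) {k r : ℕ} (hk : 2 ≤ k) (hr : 2 ≤ r)
    {N : ℝ} (hN : N = ((k * r : ℕ) : ℝ) / (k - 1)) (hs1 : 1 ≤ saddle κ N)
    (hsr : saddle κ N ≤ r / 2) :
    relLower β κ N * (saddle κ N ^ 2 / N) ≤ logPhi β k r (saddle κ N) := by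
  have hr' : (2 : ℝ) ≤ r := by exact_mod_cast hr
  have hrN := le_mul_div_sub_one_and_le (r := r) hk
  rw [← hN] at hrN
  have hN1 : 1 < N := by linarith
  have hL : 0 < Real.log N := Real.log_pos hN1
  have h := le_logPhi β hk hr (by linarith) hsr
  rw [← hN] at h
  have hlog : 0 ≤ Real.log (saddle κ N) := Real.log_nonneg hs1
  have hcube : 2 * saddle κ N ^ 3 / (r : ℝ) ^ 2 ≤ 8 * κ / Real.log N := by
    rw [saddle_pow_three hκ hN1, div_le_div_iff₀ (by positivity) hL]
    have : 2 * (κ * N ^ 2 / Real.log N) * Real.log N = 2 * κ * N ^ 2 := by field_simp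
    rw [this]
    have hsq : N ^ 2 ≤ (2 * r) ^ 2 := by gcongr; exact hrN.2
    nlinarith
  have hrel : relLower β κ N * (saddle κ N ^ 2 / N) =
      β * √(saddle κ N / Real.log (saddle κ N)) - saddle κ N ^ 2 / (2 * N) - Real.log N -
        8 * κ / Real.log N := by
    have : saddle κ N ≠ 0 := by linarith
    have : N ≠ 0 := by linarith
    rw [relLower, saddleRatio]
    field_simp
  rw [hrel]
  linarith

lemma eventually_exists_isMaxOn_logPhi {β κ : ℝ} (hβ : 0 < β) (hκ : κ = 3 * β ^ 2 / 8)
    {k : ℕ → ℕ} (hk : ∀ r, 2 ≤ k r) {N : ℕ → ℝ}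
    (hN : ∀ r, N r = ((k r * r : ℕ) : ℝ) / (k r - 1)) :
    ∀ᶠ r : ℕ in atTop, ∃ x ∈ Set.Ioo (Real.exp 2) (r : ℝ),
      IsMaxOn (logPhi β (k r) r) (Set.Ioo (Real.exp 2) (r : ℝ)) x ∧
      relLower β κ (N r) * (saddle κ (N r) ^ 2 / N r) ≤ logPhi β (k r) r x ∧
      logPhi β (k r) r x ≤ relUpper β κ (N r) * (saddle κ (N r) ^ 2 / N r) := by
  have hκ0 : 0 < κ := by rw [hκ]; positivity
  have hrN : ∀ r : ℕ, (r : ℝ) ≤ N r ∧ N r ≤ 2 * r := fun r => by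
    rw [hN]; exact le_mul_div_sub_one_and_le (hk r)
  have hNtop : Tendsto N atTop atTop :=
    tendsto_atTop_mono (fun r => (hrN r).1) tendsto_natCast_atTop_atTop
  have hsqrt : Tendsto (fun r : ℕ => √(r : ℝ)) atTop atTop :=
    Real.tendsto_sqrt_atTop.comp tendsto_natCast_atTop_atTop
  set a := Real.exp 2 + 1 with ha
  have ha0 : 0 < a := by positivity
  filter_upwards [eventually_ge_atTop 2,
    tendsto_natCast_atTop_atTop.eventually_gt_atTop (2 * a),
    ((tendsto_saddle_atTop hκ0).comp hNtop).eventually_gt_atTop a,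
    ((tendsto_saddle_div_self hκ0).comp hNtop).eventually_lt_const
      (by norm_num : (0 : ℝ) < 1 / 4),
    ((tendsto_relLower hβ hκ).comp hNtop).eventually_const_lt
      (by norm_num : (1 : ℝ) < 3 / 2),
    ((tendsto_saddle_sq_div hκ0).comp hNtop).eventually_gt_atTop
      (3 / 2 + β * √(a / Real.log a)),
    hsqrt.eventually_ge_atTop (16 * β + 24)] with r hr hra hsa hsN hlow hQ hrβ
  simp only [Function.comp] at hsa hsN hlow hQ
  have hr' : (2 : ℝ) ≤ r := by exact_mod_cast hr
  have hN1 : 1 < N r := by linarith [(hrN r).1]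
  have hN0 : 0 < N r := by linarith
  have hs0 : 0 < saddle κ (N r) := saddle_pos hκ0 hN1
  have hsr : saddle κ (N r) < r / 2 := by
    rw [div_lt_iff₀ hN0] at hsN
    linarith [(hrN r).2]
  have he : 1 ≤ Real.exp 2 := Real.one_le_exp (by norm_num)
  have hlower := relLower_mul_le_logPhi (β := β) hκ0 (hk r) hr (hN r) (by linarith) hsr.le
  have hsQ : saddle κ (N r) ^ 2 / N r < logPhi β (k r) r (saddle κ (N r)) :=
    lt_of_lt_of_le ((lt_mul_iff_one_lt_left (by positivity)).2 hlow) hlower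
  have hfa : logPhi β (k r) r a < logPhi β (k r) r (saddle κ (N r)) := by
    have h := logPhi_le β (hk r) hr ha0 (by linarith)
    rw [← hN r] at h
    have : 0 ≤ a ^ 2 / (2 * N r) := by positivity
    linarith
  have hfd : logPhi β (k r) r ((r : ℝ) / 2) < logPhi β (k r) r (saddle κ (N r)) := by
    have h := logPhi_le β (hk r) hr (x := (r : ℝ) / 2) (by linarith) (by linarith)
    rw [← hN r] at h
    have hd2 : 2 < Real.log ((r : ℝ) / 2) :=
      two_lt_log_of_exp_two_lt (Set.mem_Ioi.2 (by linarith))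
    have h1 : √((r : ℝ) / 2 / Real.log ((r : ℝ) / 2)) ≤ √(r : ℝ) := by
      apply Real.sqrt_le_sqrt
      rw [div_le_iff₀ (by linarith)]
      nlinarith
    have h2 : (r : ℝ) / 16 ≤ ((r : ℝ) / 2) ^ 2 / (2 * N r) := by
      rw [div_le_div_iff₀ (by norm_num) (by positivity)]
      nlinarith [(hrN r).2]
    have h3 : √(r : ℝ) ^ 2 = r := Real.sq_sqrt (by linarith)
    have h4 := mul_le_mul_of_nonneg_left h1 hβ.le
    have h5 : 0 < saddle κ (N r) ^ 2 / N r := by positivity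
    nlinarith
  obtain ⟨x, hx, hmax⟩ := (strictConcaveOn_logPhi hβ.le (k r) r).exists_isMaxOn_Ioo
    (a := a) (by linarith) hsa hsr (by linarith) hfa hfd
  refine ⟨x, hx, hmax, hlower.trans (hmax ⟨by linarith, by linarith⟩), ?_⟩
  have hx0 : 0 < x := (Real.exp_pos 2).trans hx.1
  have h := logPhi_le β (hk r) hr hx0 hx.2
  rw [← hN r] at h
  exact h.trans (neg_sq_div_add_sqrt_le hβ hκ0 hN1 (Set.mem_Ioi.2 (by linarith)) hx.1)

lemma const_mul_rpow_div_eq {β κ kε N : ℝ} (hβ : 0 < β) (hκ : κ = 3 * β ^ 2 / 8)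
    (hkε : kε = (3 ^ 5 * β ^ 4 : ℝ) ^ ((1 : ℝ) / 3) / 8) (hN : 1 < N) :
    kε * N ^ ((1 : ℝ) / 3) / Real.log N ^ ((2 : ℝ) / 3) = 3 / 2 * (saddle κ N ^ 2 / N) := by
  have hκ0 : 0 < κ := by rw [hκ]; positivity
  have hL : 0 < Real.log N := Real.log_pos hN
  have hN0 : 0 < N := by linarith
  have hs := saddle_pos hκ0 hN
  have hkε0 : 0 ≤ kε := by rw [hkε]; positivity
  refine (pow_left_inj₀ (by positivity) (by positivity) three_ne_zero).1 ?_
  rw [div_pow, mul_pow, mul_pow, div_pow _ N, ← pow_mul, mul_comm 2 3, pow_mul,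
    saddle_pow_three hκ0 hN, hkε, div_pow, ← Real.rpow_natCast (_ ^ ((1 : ℝ) / 3)),
    ← Real.rpow_mul (by positivity), ← Real.rpow_natCast (N ^ _), ← Real.rpow_mul hN0.le,
    ← Real.rpow_natCast (Real.log N ^ _), ← Real.rpow_mul hL.le, hκ]
  norm_num
  field_simp
  norm_num

/-- the function `φ_{n,ε}` has a unique maximum `x_*` on `(c, r)`
for large `r`, and `log φ_{n,ε}(x_*) = k_ε (n/λ)^{1/3} / log^{2/3}(n/λ) (1+o(1))`. -/
theorem stmt_6 (k n : ℕ → ℕ) (α : ℝ) (hα1 : 0 < α) (hα2 : α < 1)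
    (hk : ∀ r, 2 ≤ k r) (hn : ∀ r, n r = k r * r)
    (hko : (fun r : ℕ => (k r : ℝ)) =o[atTop] (fun r : ℕ => (n r : ℝ) ^ (1 - α)))
    (ε : ℝ) (hε1 : -1 < ε) (hε2 : ε < 1)
    (I βε kε : ℝ)
    (hI : I = ∫ t in Set.Ioi (0 : ℝ),
      Real.log (Real.log (Real.exp 1 / (1 - Real.exp (-t)))))
    (hβ : βε = Real.sqrt (8 * I) + ε)
    (hkε : kε = (3 ^ 5 * βε ^ 4 : ℝ) ^ ((1 : ℝ) / 3) / 8)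
    (φ : ℕ → ℝ → ℝ)
    (hφ : ∀ r x, φ r x =
      ((k r : ℝ) - 1) * x * (k r : ℝ) ^ (x - 1) *
        (Real.Gamma (r : ℝ) / Real.Gamma ((r : ℝ) - x + 1)) *
        (Real.Gamma ((n r : ℝ) - x) / Real.Gamma (n r : ℝ)) *
        Real.exp (βε * Real.sqrt (x / Real.log x))) :
    ∃ c : ℝ, 0 < c ∧ ∃ xstar : ℕ → ℝ,
      (∀ᶠ r : ℕ in atTop,
        xstar r ∈ Set.Ioo c (r : ℝ) ∧
        (∀ x ∈ Set.Ioo c (r : ℝ), φ r x ≤ φ r (xstar r)) ∧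
        (∀ x ∈ Set.Ioo c (r : ℝ), φ r x = φ r (xstar r) → x = xstar r)) ∧
      ∃ e : ℕ → ℝ, Tendsto e atTop (nhds 0) ∧
        ∀ᶠ r : ℕ in atTop,
          Real.log (φ r (xstar r)) =
            kε * ((n r : ℝ) / ((k r : ℝ) - 1)) ^ ((1 : ℝ) / 3) /
              (Real.log ((n r : ℝ) / ((k r : ℝ) - 1))) ^ ((2 : ℝ) / 3) * (1 + e r) := by
  obtain rfl : n = fun r => k r * r := funext hn
  have hβ0 : 0 < βε := by
    have hI' : 1 / 2 ≤ I := hI ▸ half_le_integral_log_log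
    have : 1 ≤ √(8 * I) := Real.one_le_sqrt.2 (by linarith)
    linarith
  obtain ⟨κ, hκ⟩ : ∃ κ, κ = 3 * βε ^ 2 / 8 := ⟨_, rfl⟩
  have hκ0 : 0 < κ := by rw [hκ]; positivity
  set N : ℕ → ℝ := fun r => ((k r * r : ℕ) : ℝ) / ((k r : ℝ) - 1) with hN
  have hNtop : Tendsto N atTop atTop :=
    tendsto_atTop_mono (fun r => (le_mul_div_sub_one_and_le (hk r)).1)
      tendsto_natCast_atTop_atTop
  have hmax := eventually_exists_isMaxOn_logPhi hβ0 hκ hk (N := N) fun _ => rfl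
  obtain ⟨xstar, hxstar⟩ : ∃ xstar : ℕ → ℝ, ∀ᶠ r : ℕ in atTop,
      xstar r ∈ Set.Ioo (Real.exp 2) (r : ℝ) ∧
      IsMaxOn (logPhi βε (k r) r) (Set.Ioo (Real.exp 2) (r : ℝ)) (xstar r) ∧
      relLower βε κ (N r) * (saddle κ (N r) ^ 2 / N r) ≤ logPhi βε (k r) r (xstar r) ∧
      logPhi βε (k r) r (xstar r) ≤ relUpper βε κ (N r) * (saddle κ (N r) ^ 2 / N r) :=
    hmax.choice
  have hφexp : ∀ r : ℕ, 2 ≤ r → ∀ x ∈ Set.Ioo (Real.exp 2) (r : ℝ),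
      φ r x = Real.exp (logPhi βε (k r) r x) := fun r hr x hx => by
    rw [hφ, ← phi_eq_exp_logPhi βε (hk r) hr ((Real.exp_pos 2).trans hx.1) hx.2]
  refine ⟨Real.exp 2, Real.exp_pos 2, xstar, ?_, fun r =>
    Real.log (φ r (xstar r)) / (3 / 2 * (saddle κ (N r) ^ 2 / N r)) - 1, ?_, ?_⟩
  · filter_upwards [hxstar, eventually_ge_atTop 2] with r ⟨hx, hm, _⟩ hr
    refine ⟨hx, fun y hy => ?_, fun y hy hxy => ?_⟩
    · rw [hφexp r hr y hy, hφexp r hr _ hx]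
      exact Real.exp_le_exp.2 (hm hy)
    · rw [hφexp r hr y hy, hφexp r hr _ hx, Real.exp_eq_exp] at hxy
      have hmy : IsMaxOn (logPhi βε (k r) r) (Set.Ioo (Real.exp 2) (r : ℝ)) y :=
        fun z hz => (hm hz).trans_eq hxy.symm
      exact (strictConcaveOn_logPhi hβ0.le (k r) r).eq_of_isMaxOn hmy hm hy hx
  · have hlim : Tendsto (fun r => Real.log (φ r (xstar r)) / (saddle κ (N r) ^ 2 / N r))
        atTop (nhds (3 / 2)) := by
      refine tendsto_of_tendsto_of_tendsto_of_le_of_le'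
        ((tendsto_relLower hβ0 hκ).comp hNtop) ((tendsto_relUpper hβ0 hκ).comp hNtop) ?_ ?_
      all_goals
        filter_upwards [hxstar, eventually_ge_atTop 2, hNtop.eventually_gt_atTop 1]
          with r ⟨hx, _, hlow, hup⟩ hr hN1
        have hs := saddle_pos hκ0 hN1
        have hQ : 0 < saddle κ (N r) ^ 2 / N r := div_pos (by positivity) (by linarith)
        rw [hφexp r hr _ hx, Real.log_exp]
      · exact (le_div_iff₀ hQ).2 hlow
      · exact (div_le_iff₀ hQ).2 hup
    have h := (hlim.div_const (3 / 2)).sub_const 1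
    rw [show (3 / 2 : ℝ) / (3 / 2) - 1 = 0 by norm_num] at h
    exact h.congr fun r => by rw [div_div, mul_comm (3 / 2 : ℝ)]
  · filter_upwards [hNtop.eventually_gt_atTop 1] with r hN1
    have hs := saddle_pos hκ0 hN1
    have hQ : 3 / 2 * (saddle κ (N r) ^ 2 / N r) ≠ 0 :=
      mul_ne_zero (by norm_num) (div_pos (by positivity) (by linarith)).ne'
    have heq : kε * (((k r * r : ℕ) : ℝ) / ((k r : ℝ) - 1)) ^ ((1 : ℝ) / 3) /
        Real.log (((k r * r : ℕ) : ℝ) / ((k r : ℝ) - 1)) ^ ((2 : ℝ) / 3) = _ :=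
      const_mul_rpow_div_eq hβ0 hκ hkε hN1
    rw [heq, add_sub_cancel, mul_div_cancel₀ _ hQ]
end
end
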